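/- arXiv:2501.07644 — 2 statements merged into one kernel-verified Lean document; each statement's English description precedes it below -/
import Mathlib

section
/- In the Setup: let H be a loose Hamilton cycle in G and P_0 ⊆ H a loose path of length t. Let E_p ⊆ E(H) be a random subset obtained by including each edge of H independently with probability p = (m-1)(k-1)/n, let 𝒫_p be the collection of increasing paths of length t in H starting from the edges of E_p, and let 𝒫_* = 𝒫_p ∪ {P_0}. Then each of the following five events has probability at most 1/m: ℰ_1 = {V(𝒫_p) contains a spread (k-1)-element set S such that at least εm/4 edges of G[V(𝒫_*)] containing S share a colour with an edge of H}; ℰ_2 = {V(𝒫_p) contains e ∪ f for some pair of edges e,f ∈ E(G) with χ(e)=χ(f), |e ∩ f| ≤ 1 and e ∪ f spread}; ℰ_3 = {V(𝒫_p) contains e ∪ f for some pair of disjoint edges e,f ∈ E(G) with χ(e)=χ(f) and e ∪ f almost spread}; ℰ_4 = {δ_j(G[V(𝒫_*)]) < (δ_j^k(1)+3ε/4)·M^{k-j}}; ℰ_5 = {V(𝒫_*) contains a pair of close vertices lying in distinct paths of 𝒫_*}. -/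
open Finset

open scoped Classical

noncomputable section

/-- A `k`-uniform hypergraph with vertices drawn from `ℕ`. -/
structure HGraph (k : ℕ) where
  verts : Finset ℕ
  edges : Finset (Finset ℕ)
  edge_sub : ∀ e ∈ edges, e ⊆ verts
  edge_card : ∀ e ∈ edges, e.card = k

namespace HGraph

variable {k : ℕ}

/-- The number of edges of `G` containing the vertex set `S`. -/
def degOn (G : HGraph k) (S : Finset ℕ) : ℕ :=
  (G.edges.filter fun e => S ⊆ e).card

/-- The relative degree `deg_G(S; W)`: edges containing `S` whose other vertices lie in `W`. -/
def degIn (G : HGraph k) (S W : Finset ℕ) : ℕ :=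
  (G.edges.filter fun e => S ⊆ e ∧ e \ S ⊆ W).card

/-- The edge set of the induced subhypergraph `G[U]`. -/
def inducedEdges (G : HGraph k) (U : Finset ℕ) : Finset (Finset ℕ) :=
  G.edges.filter fun e => e ⊆ U

/-- `δ_j(G) ≥ d`. -/
def MinDegGe (G : HGraph k) (j : ℕ) (d : ℝ) : Prop :=
  ∀ T ⊆ G.verts, T.card = j → d ≤ (G.degOn T : ℝ)

/-- `δ_j(G[U]) ≥ d`. -/
def MinDegOnGe (G : HGraph k) (j : ℕ) (U : Finset ℕ) (d : ℝ) : Prop :=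
  ∀ T ⊆ U, T.card = j → d ≤ (((G.inducedEdges U).filter fun e => T ⊆ e).card : ℝ)

end HGraph

/-- A colouring is rainbow on a set of edges if distinct edges receive distinct colours. -/
def RainbowEdges (χ : Finset ℕ → ℕ) (E : Finset (Finset ℕ)) : Prop :=
  ∀ e ∈ E, ∀ f ∈ E, χ e = χ f → e = f

/-- `χ` is globally `b`-bounded on `G`: every colour class has at most `b` edges. -/
def GloballyBounded {k : ℕ} (G : HGraph k) (χ : Finset ℕ → ℕ) (b : ℝ) : Prop :=
  ∀ c : ℕ, ((G.edges.filter fun e => χ e = c).card : ℝ) ≤ b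

/-- The number of edges of a loose Hamilton cycle of `G`. -/
def numE {k : ℕ} (G : HGraph k) : ℕ := G.verts.card / (k - 1)

/-- A loose Hamilton cycle in `G`, recorded by a cyclic ordering of the vertices:
`σ` enumerates the vertices, and the `i`-th edge consists of the `k` consecutive
vertices starting at position `i(k-1)`, so that consecutive edges share exactly one
vertex (when `(k-1) ∣ |V(G)|`). -/
structure LooseHamCycle (k : ℕ) (G : HGraph k) where
  σ : ℕ → ℕ
  injOn : Set.InjOn σ (Set.Iio G.verts.card)
  image_eq : (Finset.range G.verts.card).image σ = G.verts
  edges_mem : ∀ i < numE G,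
    (Finset.range k).image (fun r => σ ((i * (k - 1) + r) % G.verts.card)) ∈ G.edges

namespace LooseHamCycle

variable {k : ℕ} {G : HGraph k}

/-- The `i`-th edge of the cycle. -/
def cedge (H : LooseHamCycle k G) (i : ℕ) : Finset ℕ :=
  (Finset.range k).image fun r => H.σ ((i * (k - 1) + r) % G.verts.card)

/-- The edge set of the cycle. -/
def cedges (H : LooseHamCycle k G) : Finset (Finset ℕ) :=
  (Finset.range (numE G)).image H.cedge

/-- The edge set of the increasing loose path of length `t` starting at edge `i`. -/
def pEdges (H : LooseHamCycle k G) (i t : ℕ) : Finset (Finset ℕ) :=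
  (Finset.range t).image fun r => H.cedge ((i + r) % numE G)

/-- The vertex set of the increasing loose path of length `t` starting at edge `i`. -/
def pVerts (H : LooseHamCycle k G) (i t : ℕ) : Finset ℕ :=
  (Finset.range (t * (k - 1) + 1)).image fun r => H.σ ((i * (k - 1) + r) % G.verts.card)

/-- The first endvertex of the increasing loose path starting at edge `i`. -/
def pEndA (H : LooseHamCycle k G) (i : ℕ) : ℕ := H.σ ((i * (k - 1)) % G.verts.card)

/-- The last endvertex of the increasing loose path of length `t` starting at edge `i`. -/
def pEndB (H : LooseHamCycle k G) (i t : ℕ) : ℕ :=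
  H.σ ((i * (k - 1) + t * (k - 1)) % G.verts.card)

/-- The endvertex pair of the increasing loose path of length `t` starting at edge `i`. -/
def pEnds (H : LooseHamCycle k G) (i t : ℕ) : Finset ℕ := {H.pEndA i, H.pEndB i t}

end LooseHamCycle

/-- The loose Hamilton cycle threshold `δ_j^k(1)`: the least `δ ≥ 0` such that for every
`ε > 0` all sufficiently large `k`-graphs `G` (with `(k-1) ∣ n`) satisfying
`δ_j(G) ≥ (δ+ε)n^{k-j}` contain a loose Hamilton cycle. -/
noncomputable def looseHamThreshold (j k : ℕ) : ℝ :=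
  sInf {δ : ℝ | 0 ≤ δ ∧ ∀ ε : ℝ, 0 < ε → ∃ n₀ : ℕ, ∀ n : ℕ, n₀ ≤ n → (k - 1) ∣ n →
    ∀ G : HGraph k, G.verts.card = n →
      G.MinDegGe j ((δ + ε) * (n : ℝ) ^ (k - j)) → Nonempty (LooseHamCycle k G)}

/-- `T = t(k-1)+1`. -/
def TOf (k t : ℕ) : ℕ := t * (k - 1) + 1
/-- `m̃ = t^{100k}`. -/
def mtOf (k t : ℕ) : ℕ := t ^ (100 * k)
/-- `m = T·m̃`. -/
def mOf (k t : ℕ) : ℕ := TOf k t * mtOf k t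
/-- `M = T·m`. -/
def MOf (k t : ℕ) : ℕ := TOf k t * mOf k t

section Splittings

variable {k : ℕ} {G : HGraph k}

/-- `I` is the index set of a `t`-balanced splitting of `H`: a collection of
pairwise vertex-disjoint increasing loose paths of length `t` of `H`. -/
def IsSplitting (H : LooseHamCycle k G) (t : ℕ) (I : Finset ℕ) : Prop :=
  (∀ i ∈ I, i < numE G) ∧
    ∀ i ∈ I, ∀ i' ∈ I, i ≠ i' → Disjoint (H.pVerts i t) (H.pVerts i' t)

/-- `V(𝒫)` for the splitting indexed by `I`. -/
def splitVerts (H : LooseHamCycle k G) (t : ℕ) (I : Finset ℕ) : Finset ℕ :=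
  I.biUnion fun i => H.pVerts i t

/-- `V^E(𝒫)` for the splitting indexed by `I`. -/
def splitEnds (H : LooseHamCycle k G) (t : ℕ) (I : Finset ℕ) : Finset ℕ :=
  I.biUnion fun i => H.pEnds i t

/-- `V^I(𝒫)` for the splitting indexed by `I`. -/
def splitInt (H : LooseHamCycle k G) (t : ℕ) (I : Finset ℕ) : Finset ℕ :=
  splitVerts H t I \ splitEnds H t I

/-- A vertex set `S` is transverse with respect to the splitting indexed by `I`. -/
def Transverse (H : LooseHamCycle k G) (t : ℕ) (I : Finset ℕ) (S : Finset ℕ) : Prop :=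
  ∀ i ∈ I, (S ∩ H.pVerts i t).card ≤ 1

/-- The splitting indexed by `I` is suitable for the path `P₀` (the increasing path
of length `t` starting at edge `i₀`). -/
def Suitable (χ : Finset ℕ → ℕ) (ε : ℝ) (m : ℕ) (H : LooseHamCycle k G)
    (t : ℕ) (I : Finset ℕ) (i₀ : ℕ) : Prop :=
  (∀ S ⊆ splitVerts H t I \ H.pVerts i₀ t, S.card = k - 1 → Transverse H t I S →
    ((((G.inducedEdges (splitVerts H t I)).filter
        fun e => S ⊆ e ∧ ∃ f ∈ H.cedges, χ f = χ e).card : ℝ) ≤ ε * (m : ℝ) / 4)) ∧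
  (∀ X ⊆ splitVerts H t I \ H.pVerts i₀ t, Transverse H t I X →
    ∀ e ∈ G.inducedEdges X, ∀ f ∈ G.inducedEdges X,
      χ e = χ f → (e ∩ f).card = 1 → False) ∧
  (∀ e ∈ G.inducedEdges (splitVerts H t I \ H.pVerts i₀ t),
    ∀ f ∈ G.inducedEdges (splitVerts H t I \ H.pVerts i₀ t),
      χ e = χ f → Disjoint e f → Transverse H t I e → Transverse H t I f →
      ∃ i ∈ I, ∃ i' ∈ I, i ≠ i' ∧
        (H.pVerts i t ∩ e).Nonempty ∧ (H.pVerts i t ∩ f).Nonempty ∧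
        (H.pVerts i' t ∩ e).Nonempty ∧ (H.pVerts i' t ∩ f).Nonempty)

/-- The cyclic successor of `i` within the index set `I`. -/
def nextIdx (I : Finset ℕ) (i : ℕ) : ℕ :=
  if h : (I.filter fun i' => i < i').Nonempty then (I.filter fun i' => i < i').min' h
  else if h2 : I.Nonempty then I.min' h2 else 0

/-- `M` is a rerouting of the splitting indexed by `I`: a partition of `V^E(𝒫)` into
pairs such that identifying the two vertices of each pair connects the paths of
`H[V(G) ∖ V^I(𝒫)]` into a single loose cycle (the arcs of `H` between consecutive
paths of the splitting, together with the identified pairs, form a connected graph). -/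
def IsRerouting (H : LooseHamCycle k G) (t : ℕ) (I : Finset ℕ)
    (M : Finset (Finset ℕ)) : Prop :=
  (∀ p ∈ M, p.card = 2 ∧ p ⊆ splitEnds H t I) ∧
  (∀ p ∈ M, ∀ q ∈ M, p ≠ q → Disjoint p q) ∧
  M.biUnion id = splitEnds H t I ∧
  ∀ u ∈ splitEnds H t I, ∀ v ∈ splitEnds H t I,
    Relation.ReflTransGen
      (fun a b => ({a, b} : Finset ℕ) ∈ M ∨
        ∃ i ∈ I, ({a, b} : Finset ℕ) = {H.pEndB i t, H.pEndA (nextIdx I i)}) u v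

/-- `X` (indexed over `Finset.range T`) is a viable partition of `V(𝒫)` for the
`t`-balanced splitting indexed by `I`. -/
def IsViablePartition (j : ℕ) (ε : ℝ) (t : ℕ) (H : LooseHamCycle k G)
    (I : Finset ℕ) (X : ℕ → Finset ℕ) : Prop :=
  (Finset.range (TOf k t)).biUnion X = splitVerts H t I ∧
  (∀ h ∈ Finset.range (TOf k t), ∀ h' ∈ Finset.range (TOf k t), h ≠ h' →
    Disjoint (X h) (X h')) ∧
  (∀ h ∈ Finset.range (TOf k t), Transverse H t I (X h)) ∧
  (∃ M : Finset (Finset ℕ), IsRerouting H t I M ∧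
    ∀ h ∈ Finset.range (TOf k t), (M.filter fun p => p ⊆ X h).card = mtOf k t) ∧
  ∀ h ∈ Finset.range (TOf k t),
    G.MinDegOnGe j (X h) ((looseHamThreshold j k + ε / 2) * (mOf k t : ℝ) ^ (k - j))

/-- The vertex set spanned by a set of edges. -/
def eVerts (E : Finset (Finset ℕ)) : Finset ℕ := E.biUnion id

/-- `(𝒫, H', 𝒫')` is a `(P₀,H)`-switching of size `m`, where `𝒫` is the `t`-balanced
splitting of `H` indexed by `I` containing `P₀` (the increasing path of length `t`
starting at edge `i₀`), and `𝒫'` is the `2t`-bounded splitting of `H'` whose paths are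
recorded in `Q` as pairs (edge set, endvertex pair). -/
def IsSwitching (t m : ℕ) (H : LooseHamCycle k G) (i₀ : ℕ) (I : Finset ℕ)
    (H' : LooseHamCycle k G) (Q : Finset (Finset (Finset ℕ) × Finset ℕ)) : Prop :=
  IsSplitting H t I ∧ I.card = m ∧ i₀ ∈ I ∧
  Q.card = m ∧
  (∀ q ∈ Q, ∃ i ℓ : ℕ, i < numE G ∧ 1 ≤ ℓ ∧ ℓ ≤ 2 * t ∧
    q.1 = H'.pEdges i ℓ ∧ q.2 = H'.pEnds i ℓ) ∧
  (∀ q ∈ Q, ∀ q' ∈ Q, q ≠ q' → Disjoint (eVerts q.1) (eVerts q'.1)) ∧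
  splitInt H t I = (Q.biUnion fun q => eVerts q.1) \ (Q.biUnion fun q => q.2) ∧
  H.cedges.filter (fun e => e ⊆ G.verts \ splitInt H t I) =
    H'.cedges.filter (fun e =>
      e ⊆ G.verts \ ((Q.biUnion fun q => eVerts q.1) \ (Q.biUnion fun q => q.2))) ∧
  ∀ q ∈ Q, (H.pVerts i₀ t ∩ eVerts q.1).card ≤ 1

/-- A feasible `(P₀,H)`-switching: additionally `F' = H'[V(𝒫') ∖ V(P₀)]` is rainbow and
no edge of `F'` shares a colour with an edge of `H[V(G) ∖ V^I(𝒫)]`. -/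
def IsFeasibleSwitching (χ : Finset ℕ → ℕ) (t m : ℕ) (H : LooseHamCycle k G)
    (i₀ : ℕ) (I : Finset ℕ) (H' : LooseHamCycle k G)
    (Q : Finset (Finset (Finset ℕ) × Finset ℕ)) : Prop :=
  IsSwitching t m H i₀ I H' Q ∧
  RainbowEdges χ (H'.cedges.filter fun e =>
    e ⊆ (Q.biUnion fun q => eVerts q.1) \ H.pVerts i₀ t) ∧
  ∀ e ∈ H'.cedges.filter (fun e =>
      e ⊆ (Q.biUnion fun q => eVerts q.1) \ H.pVerts i₀ t),
    ∀ f ∈ H.cedges.filter (fun f => f ⊆ G.verts \ splitInt H t I), χ e ≠ χ f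

/-- Two vertices are close (with respect to `H` and `t`) if they lie in edges of `H`
both contained in a loose path of `H` of length at most `2t+1`. -/
def Close (H : LooseHamCycle k G) (t : ℕ) (u v : ℕ) : Prop :=
  ∃ i < numE G, ∃ i' < numE G, u ∈ H.cedge i ∧ v ∈ H.cedge i' ∧
    ∃ d ≤ 2 * t, (i + d) % numE G = i' ∨ (i' + d) % numE G = i

/-- A vertex set is spread if no two of its vertices are close. -/
def SpreadSet (H : LooseHamCycle k G) (t : ℕ) (S : Finset ℕ) : Prop :=
  ∀ u ∈ S, ∀ v ∈ S, u ≠ v → ¬ Close H t u v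

/-- A vertex set is almost spread if exactly one pair of its vertices is close. -/
def AlmostSpreadSet (H : LooseHamCycle k G) (t : ℕ) (S : Finset ℕ) : Prop :=
  ∃ u ∈ S, ∃ v ∈ S, u ≠ v ∧ Close H t u v ∧
    ∀ u' ∈ S, ∀ v' ∈ S, u' ≠ v' → Close H t u' v' → ({u', v'} : Finset ℕ) = {u, v}

end Splittings

/-- The probability that a `p`-random subset of `Finset.range N` (each element included
independently with probability `p`) satisfies `A`. -/
noncomputable def probOver (N : ℕ) (p : ℝ) (A : Finset ℕ → Prop) : ℝ :=
  ∑ S ∈ (Finset.range N).powerset,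
    if A S then p ^ S.card * (1 - p) ^ (N - S.card) else 0

/-- A loose path of length `t` in `G`, recorded by an ordering of its vertices. -/
structure LoosePath (k t : ℕ) (G : HGraph k) where
  σ : ℕ → ℕ
  injOn : Set.InjOn σ (Set.Iio (t * (k - 1) + 1))
  mem_verts : ∀ r < t * (k - 1) + 1, σ r ∈ G.verts
  edges_mem : ∀ i < t, (Finset.range k).image (fun r => σ (i * (k - 1) + r)) ∈ G.edges

namespace LoosePath

variable {k t : ℕ} {G : HGraph k}

/-- The vertex set of a loose path. -/
def verts (P : LoosePath k t G) : Finset ℕ := (Finset.range (t * (k - 1) + 1)).image P.σ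

/-- The edge set of a loose path. -/
def edgeSet (P : LoosePath k t G) : Finset (Finset ℕ) :=
  (Finset.range t).image fun i => (Finset.range k).image fun r => P.σ (i * (k - 1) + r)

/-- The first endvertex of a loose path. -/
def endA (P : LoosePath k t G) : ℕ := P.σ 0

/-- The last endvertex of a loose path. -/
def endB (P : LoosePath k t G) : ℕ := P.σ (t * (k - 1))

end LoosePath

/-! ### Probability -/

def EU (U : Finset ℕ) (p : ℝ) (f : Finset ℕ → ℝ) : ℝ :=
  ∑ S ∈ U.powerset, p ^ S.card * (1 - p) ^ (U.card - S.card) * f S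

lemma EU_insert {U : Finset ℕ} {a : ℕ} (ha : a ∉ U) (p : ℝ) (f : Finset ℕ → ℝ) :
    EU (insert a U) p f = (1 - p) * EU U p f + p * EU U p (fun S => f (insert a S)) := by
  unfold EU
  rw [Finset.sum_powerset_insert ha, Finset.mul_sum, Finset.mul_sum]
  congr 1
  · apply Finset.sum_congr rfl
    intro S hS
    have h1 : S.card ≤ U.card := Finset.card_le_card (Finset.mem_powerset.1 hS)
    rw [Finset.card_insert_of_notMem ha, Nat.succ_sub h1, pow_succ]
    ring
  · apply Finset.sum_congr rfl
    intro S hS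
    have h1 : a ∉ S := fun h => ha (Finset.mem_powerset.1 hS h)
    rw [Finset.card_insert_of_notMem ha, Finset.card_insert_of_notMem h1, Nat.add_sub_add_right,
      pow_succ]
    ring

lemma EU_const (U : Finset ℕ) (p c : ℝ) : EU U p (fun _ => c) = c := by
  induction U using Finset.induction_on with
  | empty => simp [EU]
  | insert a U ha ih => rw [EU_insert ha, ih]; ring

lemma EU_mono {U : Finset ℕ} {p : ℝ} (h0 : 0 ≤ p) (h1 : p ≤ 1) {f g : Finset ℕ → ℝ}
    (h : ∀ S ⊆ U, f S ≤ g S) : EU U p f ≤ EU U p g := by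
  apply Finset.sum_le_sum
  intro S hS
  apply mul_le_mul_of_nonneg_left (h S (Finset.mem_powerset.1 hS))
  have : 0 ≤ 1 - p := by linarith
  positivity

lemma EU_sum {ι : Type*} (U : Finset ℕ) (p : ℝ) (F : Finset ι) (f : ι → Finset ℕ → ℝ) :
    EU U p (fun S => ∑ x ∈ F, f x S) = ∑ x ∈ F, EU U p (f x) := by
  unfold EU
  rw [Finset.sum_comm]
  apply Finset.sum_congr rfl
  intro S _
  rw [Finset.mul_sum]

lemma EU_smul (U : Finset ℕ) (p c : ℝ) (f : Finset ℕ → ℝ) :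
    EU U p (fun S => c * f S) = c * EU U p f := by
  unfold EU
  rw [Finset.mul_sum]
  apply Finset.sum_congr rfl
  intro S _
  ring

lemma EU_add (U : Finset ℕ) (p : ℝ) (f g : Finset ℕ → ℝ) :
    EU U p (fun S => f S + g S) = EU U p f + EU U p g := by
  unfold EU
  rw [← Finset.sum_add_distrib]
  apply Finset.sum_congr rfl
  intro S _
  ring

/-- indicator of `J ⊆ S` -/
def ind (J S : Finset ℕ) : ℝ := if J ⊆ S then 1 else 0

lemma ind_nonneg (J S : Finset ℕ) : 0 ≤ ind J S := by
  unfold ind; split_ifs <;> norm_num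

lemma ind_insert (a : ℕ) (J S : Finset ℕ) : ind (insert a J) S = ind {a} S * ind J S := by
  unfold ind
  by_cases h1 : a ∈ S <;> by_cases h2 : J ⊆ S <;> simp [Finset.insert_subset_iff, h1, h2]

lemma EU_congr {U : Finset ℕ} {p : ℝ} {f g : Finset ℕ → ℝ}
    (h : ∀ S ⊆ U, f S = g S) : EU U p f = EU U p g := by
  apply Finset.sum_congr rfl
  intro S hS
  rw [h S (Finset.mem_powerset.1 hS)]

lemma EU_single {U : Finset ℕ} {p : ℝ} {a : ℕ} (ha : a ∈ U)
    (g : Finset ℕ → ℝ) :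
    EU U p (fun S => ind {a} S * g S) = p * EU (U.erase a) p (fun S => g (insert a S)) := by
  conv_lhs => rw [← Finset.insert_erase ha]
  rw [EU_insert (Finset.notMem_erase a U)]
  have e1 : EU (U.erase a) p (fun S => ind {a} S * g S) = 0 := by
    rw [← EU_const (U.erase a) p 0]
    apply EU_congr
    intro S hS
    have : a ∉ S := fun h => Finset.notMem_erase a U (hS h)
    simp [ind, this]
  rw [e1]
  have e2 : (fun S => ind {a} (insert a S) * g (insert a S)) = fun S => g (insert a S) := by
    funext S
    simp [ind]
  rw [e2]; ring

lemma EU_single_le {U : Finset ℕ} {p : ℝ} (h0 : 0 ≤ p) (h1 : p ≤ 1) {a : ℕ} (ha : a ∈ U)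
    {g : Finset ℕ → ℝ} (hg : ∀ S ⊆ U, a ∉ S → g (insert a S) ≤ g S) :
    EU U p (fun S => ind {a} S * g S) ≤ p * EU U p g := by
  rw [EU_single ha]
  apply mul_le_mul_of_nonneg_left _ h0
  conv_rhs => rw [← Finset.insert_erase ha]
  rw [EU_insert (Finset.notMem_erase a U)]
  have : EU (U.erase a) p (fun S => g (insert a S)) ≤ EU (U.erase a) p g := by
    apply EU_mono h0 h1
    intro S hS
    exact hg S (hS.trans (Finset.erase_subset _ _)) (fun h => Finset.notMem_erase a U (hS h))
  nlinarith

lemma EU_single_eq {U : Finset ℕ} {p : ℝ} {a : ℕ} (ha : a ∈ U)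
    {g : Finset ℕ → ℝ} (hg : ∀ S ⊆ U, a ∉ S → g (insert a S) = g S) :
    EU U p (fun S => ind {a} S * g S) = p * EU U p g := by
  rw [EU_single ha]
  congr 1
  conv_rhs => rw [← Finset.insert_erase ha]
  rw [EU_insert (Finset.notMem_erase a U)]
  have : EU (U.erase a) p (fun S => g (insert a S)) = EU (U.erase a) p g := by
    apply EU_congr
    intro S hS
    exact hg S (hS.trans (Finset.erase_subset _ _)) (fun h => Finset.notMem_erase a U (hS h))
  rw [this]; ring

lemma EU_harris {U : Finset ℕ} {p : ℝ} (h0 : 0 ≤ p) (h1 : p ≤ 1)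
    {f : Finset ℕ → ℝ} (hf : ∀ S T, S ⊆ T → f T ≤ f S) (J : Finset ℕ) (hJ : J ⊆ U) :
    EU U p (fun S => ind J S * f S) ≤ p ^ J.card * EU U p f := by
  induction J using Finset.induction_on with
  | empty => simp [ind]
  | insert a J ha ih =>
    have ih := ih ((Finset.subset_insert _ _).trans hJ)
    have haU : a ∈ U := hJ (Finset.mem_insert_self _ _)
    simp only [ind_insert, mul_assoc]
    refine (EU_single_le h0 h1 haU (g := fun S => ind J S * f S) ?_).trans ?_
    · intro S _ _
      have : ind J (insert a S) = ind J S := by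
        unfold ind; simp [Finset.subset_insert_iff_of_notMem ha]
      simp only [this]
      exact mul_le_mul_of_nonneg_left (hf _ _ (Finset.subset_insert _ _)) (ind_nonneg _ _)
    · rw [Finset.card_insert_of_notMem ha, pow_succ]
      nlinarith

lemma EU_indep {U : Finset ℕ} {p : ℝ}
    {f : Finset ℕ → ℝ} (J : Finset ℕ) (hJ : J ⊆ U)
    (hf : ∀ a ∈ J, ∀ S, f (insert a S) = f S) :
    EU U p (fun S => ind J S * f S) = p ^ J.card * EU U p f := by
  induction J using Finset.induction_on with
  | empty => simp [ind]
  | insert a J ha ih =>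
    have ih := ih ((Finset.subset_insert _ _).trans hJ)
      (fun b hb => hf b (Finset.mem_insert_of_mem hb))
    have haU : a ∈ U := hJ (Finset.mem_insert_self _ _)
    simp only [ind_insert, mul_assoc]
    rw [EU_single_eq haU (g := fun S => ind J S * f S) ?_, ih]
    · rw [Finset.card_insert_of_notMem ha, pow_succ]
      ring
    · intro S _ _
      have : ind J (insert a S) = ind J S := by
        unfold ind; simp [Finset.subset_insert_iff_of_notMem ha]
      simp only [this, hf a (Finset.mem_insert_self _ _)]

/-- weighted count -/
def XW (F : Finset (Finset ℕ)) (w : Finset ℕ → ℝ) (S : Finset ℕ) : ℝ :=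
  ∑ A ∈ F, w A * ind A S

lemma ind_mono (J : Finset ℕ) {S S' : Finset ℕ} (h : S ⊆ S') : ind J S ≤ ind J S' := by
  unfold ind
  split_ifs with h1 h2
  · exact le_rfl
  · exact absurd (h1.trans h) h2
  · norm_num
  · exact le_rfl

lemma XW_mono {F : Finset (Finset ℕ)} {w : Finset ℕ → ℝ} (hw : ∀ A, 0 ≤ w A)
    {S S' : Finset ℕ} (h : S ⊆ S') : XW F w S ≤ XW F w S' :=
  Finset.sum_le_sum fun A _ => mul_le_mul_of_nonneg_left (ind_mono A h) (hw A)

lemma ind_mul (A B S : Finset ℕ) : ind A S * ind B S = ind (A ∪ B) S := by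
  unfold ind
  by_cases h1 : A ⊆ S <;> by_cases h2 : B ⊆ S <;> simp [Finset.union_subset_iff, h1, h2]

lemma janson_key {U : Finset ℕ} {p : ℝ} (h0 : 0 ≤ p) (h1 : p ≤ 1)
    (F : Finset (Finset ℕ)) (hF : ∀ A ∈ F, A ⊆ U) (w : Finset ℕ → ℝ) (hw : ∀ A, 0 ≤ w A)
    (s : ℝ) (hs : 0 ≤ s) (A : Finset ℕ) (hA : A ∈ F) :
    (p ^ A.card - s * ∑ B ∈ F.filter (fun B => ¬ Disjoint A B), w B * p ^ (A ∪ B).card) *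
      EU U p (fun S => Real.exp (-s * XW F w S)) ≤
    EU U p (fun S => ind A S * Real.exp (-s * XW F w S)) := by
  have hpos : 0 ≤ EU U p (fun S => Real.exp (-s * XW F w S)) := by
    rw [← EU_const U p 0]
    exact EU_mono h0 h1 fun S _ => (Real.exp_pos _).le
  have hpos2 : 0 ≤ EU U p (fun S => ind A S * Real.exp (-s * XW F w S)) := by
    rw [← EU_const U p 0]
    exact EU_mono h0 h1 fun S _ => mul_nonneg (ind_nonneg _ _) (Real.exp_pos _).le
  set c := p ^ A.card - s * ∑ B ∈ F.filter (fun B => ¬ Disjoint A B), w B * p ^ (A ∪ B).card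
    with hc
  rcases le_or_gt c 0 with h | h
  · exact (mul_nonpos_of_nonpos_of_nonneg h hpos).trans hpos2
  set X1 := XW (F.filter (fun B => ¬ Disjoint A B)) w with hX1
  set Y := XW (F.filter (fun B => Disjoint A B)) w with hY
  have hXY : ∀ S, XW F w S = Y S + X1 S := fun S =>
    (Finset.sum_filter_add_sum_filter_not F (fun B => Disjoint A B) _).symm
  have hX1nn : ∀ S, 0 ≤ X1 S := fun S =>
    Finset.sum_nonneg fun B _ => mul_nonneg (hw B) (ind_nonneg _ _)
  -- replace by Y
  have step1 : c * EU U p (fun S => Real.exp (-s * XW F w S)) ≤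
      c * EU U p (fun S => Real.exp (-s * Y S)) := by
    apply mul_le_mul_of_nonneg_left _ h.le
    apply EU_mono h0 h1
    intro S _
    apply Real.exp_le_exp.2
    rw [hXY]
    nlinarith [hX1nn S]
  refine step1.trans ?_
  have hYanti : ∀ S T, S ⊆ T → Real.exp (-s * Y T) ≤ Real.exp (-s * Y S) := by
    intro S T hST
    apply Real.exp_le_exp.2
    have : Y S ≤ Y T := XW_mono hw hST
    nlinarith
  have hYind : ∀ a ∈ A, ∀ S, Real.exp (-s * Y (insert a S)) = Real.exp (-s * Y S) := by
    intro a ha S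
    have : Y (insert a S) = Y S := by
      apply Finset.sum_congr rfl
      intro B hB
      have : a ∉ B := Finset.disjoint_left.1 (Finset.mem_filter.1 hB).2 ha
      unfold ind; simp [Finset.subset_insert_iff_of_notMem this]
    rw [this]
  have e1 := EU_indep (U := U) (p := p) (f := fun S => Real.exp (-s * Y S)) A (hF A hA) hYind
  have e2 : ∀ B ∈ F.filter (fun B => ¬ Disjoint A B),
      EU U p (fun S => ind (A ∪ B) S * Real.exp (-s * Y S)) ≤
        p ^ (A ∪ B).card * EU U p (fun S => Real.exp (-s * Y S)) := fun B hB =>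
    EU_harris h0 h1 hYanti (A ∪ B)
      (Finset.union_subset (hF A hA) (hF B (Finset.mem_filter.1 hB).1))
  have e3 : EU U p (fun S => ind A S * Real.exp (-s * Y S) + (-s) *
      ∑ B ∈ F.filter (fun B => ¬ Disjoint A B), w B * (ind (A ∪ B) S * Real.exp (-s * Y S)))
      ≤ EU U p (fun S => ind A S * Real.exp (-s * XW F w S)) := by
    apply EU_mono h0 h1
    intro S _
    have h2 : Real.exp (-s * XW F w S) = Real.exp (-s * Y S) * Real.exp (-s * X1 S) := by
      rw [← Real.exp_add, hXY]; ring_nf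
    have h3 : 1 - s * X1 S ≤ Real.exp (-s * X1 S) := by
      have := Real.add_one_le_exp (-s * X1 S); linarith
    have h4 : ∑ B ∈ F.filter (fun B => ¬ Disjoint A B), w B * (ind (A ∪ B) S * Real.exp (-s * Y S))
        = ind A S * Real.exp (-s * Y S) * X1 S := by
      rw [hX1, XW, Finset.mul_sum]
      apply Finset.sum_congr rfl
      intro B _
      rw [← ind_mul]; ring
    rw [h4, h2]
    have h5 : 0 ≤ ind A S * Real.exp (-s * Y S) := mul_nonneg (ind_nonneg _ _) (Real.exp_pos _).le
    nlinarith [mul_le_mul_of_nonneg_left h3 h5]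
  refine le_trans ?_ e3
  rw [EU_add, EU_smul, EU_sum, e1]
  simp only [EU_smul]
  have e4 : ∑ B ∈ F.filter (fun B => ¬ Disjoint A B),
      w B * EU U p (fun S => ind (A ∪ B) S * Real.exp (-s * Y S)) ≤
      (∑ B ∈ F.filter (fun B => ¬ Disjoint A B), w B * p ^ (A ∪ B).card) *
        EU U p (fun S => Real.exp (-s * Y S)) := by
    rw [Finset.sum_mul]
    apply Finset.sum_le_sum
    intro B hB
    rw [mul_assoc]
    exact mul_le_mul_of_nonneg_left (e2 B hB) (hw B)
  rw [hc]
  nlinarith [mul_le_mul_of_nonneg_left e4 hs]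

lemma janson_mgf {U : Finset ℕ} {p : ℝ} (h0 : 0 ≤ p) (h1 : p ≤ 1)
    (F : Finset (Finset ℕ)) (hF : ∀ A ∈ F, A ⊆ U) (w : Finset ℕ → ℝ) (hw : ∀ A, 0 ≤ w A)
    (m D : ℝ) (hm : m = ∑ A ∈ F, w A * p ^ A.card)
    (hD : ∑ A ∈ F, w A * ∑ B ∈ F.filter (fun B => ¬ Disjoint A B), w B * p ^ (A ∪ B).card ≤ D)
    (s : ℝ) (hs : 0 ≤ s) :
    EU U p (fun S => Real.exp (-s * XW F w S)) ≤ Real.exp (-s * m + s ^ 2 * D / 2) := by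
  set Ψ : ℝ → ℝ := fun s => EU U p (fun S => Real.exp (-s * XW F w S)) with hΨ
  have hder : ∀ s, HasDerivAt Ψ (- ∑ A ∈ F, w A *
      EU U p (fun S => ind A S * Real.exp (-s * XW F w S))) s := by
    intro s
    have h2 : HasDerivAt Ψ (EU U p (fun S => Real.exp (-s * XW F w S) * (-XW F w S))) s := by
      simp only [hΨ, EU]
      apply HasDerivAt.fun_sum
      intro S _
      apply HasDerivAt.const_mul
      apply HasDerivAt.exp
      have := (hasDerivAt_id s).neg.mul_const (XW F w S)
      simpa using this
    convert h2 using 1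
    have : (fun S => Real.exp (-s * XW F w S) * (-XW F w S)) =
        fun S => (-1) * ∑ A ∈ F, w A * (ind A S * Real.exp (-s * XW F w S)) := by
      funext S
      have : ∑ A ∈ F, w A * (ind A S * Real.exp (-s * XW F w S)) =
          XW F w S * Real.exp (-s * XW F w S) := by
        generalize Real.exp (-s * XW F w S) = z
        rw [XW, Finset.sum_mul]
        apply Finset.sum_congr rfl
        intros
        ring
      rw [this]; ring
    rw [this, EU_smul, EU_sum]
    simp only [EU_smul]
    ring
  have hΨnn : ∀ s, 0 ≤ Ψ s := by
    intro s
    rw [← EU_const U p 0]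
    exact EU_mono h0 h1 fun S _ => (Real.exp_pos _).le
  set g : ℝ → ℝ := fun s => Ψ s * Real.exp (s * m - s ^ 2 * D / 2) with hg
  have hgder : ∀ s, HasDerivAt g ((- ∑ A ∈ F, w A *
      EU U p (fun S => ind A S * Real.exp (-s * XW F w S))) * Real.exp (s * m - s ^ 2 * D / 2)
      + Ψ s * (Real.exp (s * m - s ^ 2 * D / 2) * (m - s * D))) s := by
    intro s
    apply (hder s).mul
    apply HasDerivAt.exp
    have := ((hasDerivAt_id s).mul_const m).sub
      ((((hasDerivAt_id s).pow 2).mul_const D).div_const 2)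
    refine this.congr_deriv ?_
    simp
    ring
  have hanti : AntitoneOn g (Set.Ici 0) := by
    apply antitoneOn_of_deriv_nonpos (convex_Ici 0)
    · exact fun x _ => (hgder x).continuousAt.continuousWithinAt
    · exact fun x _ => (hgder x).differentiableAt.differentiableWithinAt
    · intro x hx
      rw [interior_Ici] at hx
      have hx : 0 < x := hx
      rw [(hgder x).deriv]
      have key : (m - x * D) * Ψ x ≤
          ∑ A ∈ F, w A * EU U p (fun S => ind A S * Real.exp (-x * XW F w S)) := by
        calc (m - x * D) * Ψ x ≤ (∑ A ∈ F, w A * (p ^ A.card - x *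
              ∑ B ∈ F.filter (fun B => ¬ Disjoint A B), w B * p ^ (A ∪ B).card)) * Ψ x := by
              apply mul_le_mul_of_nonneg_right _ (hΨnn x)
              have : ∑ A ∈ F, w A * (p ^ A.card - x *
                ∑ B ∈ F.filter (fun B => ¬ Disjoint A B), w B * p ^ (A ∪ B).card) =
                m - x * ∑ A ∈ F, w A *
                  ∑ B ∈ F.filter (fun B => ¬ Disjoint A B), w B * p ^ (A ∪ B).card := by
                rw [hm, Finset.mul_sum, ← Finset.sum_sub_distrib]
                apply Finset.sum_congr rfl
                intros
                ring
              rw [this]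
              nlinarith [mul_le_mul_of_nonneg_left hD hx.le]
          _ ≤ _ := by
              rw [Finset.sum_mul]
              apply Finset.sum_le_sum
              intro A hA
              rw [mul_assoc]
              exact mul_le_mul_of_nonneg_left
                (janson_key h0 h1 F hF w hw x hx.le A hA) (hw A)
      have he := Real.exp_pos (x * m - x ^ 2 * D / 2)
      nlinarith [mul_le_mul_of_nonneg_right key he.le]
  have h2 := hanti (Set.mem_Ici.2 le_rfl) (Set.mem_Ici.2 hs) hs
  have h3 : g 0 = 1 := by
    simp only [hg, hΨ]
    simp [EU_const]
  rw [h3] at h2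
  have h4 : Ψ s = g s * Real.exp (-s * m + s ^ 2 * D / 2) := by
    simp only [hg]
    rw [mul_assoc, ← Real.exp_add]
    ring_nf
    simp
  change Ψ s ≤ _
  rw [h4]
  calc _ ≤ 1 * Real.exp (-s * m + s ^ 2 * D / 2) :=
        mul_le_mul_of_nonneg_right h2 (Real.exp_pos _).le
    _ = _ := one_mul _

/-- Joint version: `P(J ⊆ S ∧ X_S ≤ m - l) ≤ p^|J| exp(-l²/(2D))`. -/
lemma janson_joint {U : Finset ℕ} {p : ℝ} (h0 : 0 ≤ p) (h1 : p ≤ 1)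
    (F : Finset (Finset ℕ)) (hF : ∀ A ∈ F, A ⊆ U) (w : Finset ℕ → ℝ) (hw : ∀ A, 0 ≤ w A)
    (x l D : ℝ) (hl : 0 ≤ l) (hm : x + l ≤ ∑ A ∈ F, w A * p ^ A.card) (hD0 : 0 < D)
    (hD : ∑ A ∈ F, w A * ∑ B ∈ F.filter (fun B => ¬ Disjoint A B), w B * p ^ (A ∪ B).card ≤ D)
    (J : Finset ℕ) (hJ : J ⊆ U) :
    EU U p (fun S => if J ⊆ S ∧ XW F w S < x then 1 else 0) ≤
      p ^ J.card * Real.exp (- (l ^ 2 / (2 * D))) := by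
  have hs : 0 ≤ l / D := by positivity
  have a1 : EU U p (fun S => if J ⊆ S ∧ XW F w S < x then 1 else 0) ≤
      EU U p (fun S => Real.exp (l / D * x) * (ind J S * Real.exp (-(l / D) * XW F w S))) := by
    apply EU_mono h0 h1
    intro S _
    split_ifs with h
    · have : ind J S = 1 := by simp [ind, h.1]
      rw [this, one_mul, ← Real.exp_add]
      apply Real.one_le_exp
      nlinarith [mul_le_mul_of_nonneg_left h.2.le hs]
    · exact mul_nonneg (Real.exp_pos _).le (mul_nonneg (ind_nonneg _ _) (Real.exp_pos _).le)
  refine a1.trans ?_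
  rw [EU_smul]
  have a2 := EU_harris h0 h1 (U := U) (f := fun S => Real.exp (-(l / D) * XW F w S)) (by
    intro S T hST
    apply Real.exp_le_exp.2
    nlinarith [mul_le_mul_of_nonneg_left (XW_mono (F := F) hw hST) hs]) J hJ
  have a3 := janson_mgf h0 h1 F hF w hw _ D rfl hD (l / D) hs
  calc _ ≤ Real.exp (l / D * x) * (p ^ J.card * Real.exp (-(l / D) *
            (∑ A ∈ F, w A * p ^ A.card) + (l / D) ^ 2 * D / 2)) := by
        apply mul_le_mul_of_nonneg_left _ (Real.exp_pos _).le
        exact a2.trans (mul_le_mul_of_nonneg_left a3 (pow_nonneg h0 _))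
    _ = p ^ J.card * Real.exp (l / D * x + (-(l / D) *
            (∑ A ∈ F, w A * p ^ A.card) + (l / D) ^ 2 * D / 2)) := by
        rw [Real.exp_add (l / D * x)]; ring
    _ ≤ _ := by
        apply mul_le_mul_of_nonneg_left _ (pow_nonneg h0 _)
        apply Real.exp_le_exp.2
        have e : (l / D) ^ 2 * D / 2 = l / D * l - l ^ 2 / (2 * D) := by
          field_simp; ring
        rw [e]
        nlinarith [mul_le_mul_of_nonneg_left hm hs]

lemma probOver_eq (N : ℕ) (p : ℝ) (A : Finset ℕ → Prop) :
    probOver N p A = EU (Finset.range N) p (fun S => if A S then 1 else 0) := by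
  unfold probOver EU
  apply Finset.sum_congr rfl
  intro S _
  simp

lemma EU_ind {U : Finset ℕ} {p : ℝ} (J : Finset ℕ) (hJ : J ⊆ U) :
    EU U p (ind J) = p ^ J.card := by
  have := EU_indep (U := U) (p := p) (f := fun _ => 1) J hJ (fun _ _ _ => rfl)
  rw [EU_const] at this
  simpa using this

/-- union bound -/
lemma probOver_union {ι : Type*} {N : ℕ} {p : ℝ} (h0 : 0 ≤ p) (h1 : p ≤ 1)
    (A : Finset ℕ → Prop) (F : Finset ι) (B : ι → Finset ℕ → Prop)
    (h : ∀ S ⊆ Finset.range N, A S → ∃ x ∈ F, B x S) :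
    probOver N p A ≤ ∑ x ∈ F, probOver N p (B x) := by
  simp only [probOver_eq]
  rw [← EU_sum]
  apply EU_mono h0 h1
  intro S hS
  have hn : ∀ x ∈ F, (0:ℝ) ≤ if B x S then 1 else 0 := by
    intro x _; split_ifs <;> norm_num
  split_ifs with hA
  · obtain ⟨x, hx, hB⟩ := h S hS hA
    refine le_trans ?_ (Finset.single_le_sum hn hx)
    simp [hB]
  · exact Finset.sum_nonneg hn

lemma probOver_sup {N : ℕ} {p : ℝ} (J : Finset ℕ) (hJ : J ⊆ Finset.range N) :
    probOver N p (fun S => J ⊆ S) = p ^ J.card := by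
  rw [probOver_eq, ← EU_ind J hJ]; apply EU_congr; intro S _; simp [ind]

lemma probOver_mono {N : ℕ} {p : ℝ} (h0 : 0 ≤ p) (h1 : p ≤ 1)
    (A B : Finset ℕ → Prop) (h : ∀ S ⊆ Finset.range N, A S → B S) :
    probOver N p A ≤ probOver N p B := by
  simpa using probOver_union h0 h1 A (Finset.range 1) (fun _ => B)
    (fun S hS hA => ⟨0, by simp, h S hS hA⟩)

lemma probOver_or {N : ℕ} {p : ℝ} (h0 : 0 ≤ p) (h1 : p ≤ 1)
    (A B C : Finset ℕ → Prop) (h : ∀ S ⊆ Finset.range N, A S → B S ∨ C S) :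
    probOver N p A ≤ probOver N p B + probOver N p C := by
  have := probOver_union h0 h1 A (Finset.univ : Finset Bool) (fun b => if b then B else C)
    (fun S hS hA => by
      rcases h S hS hA with h | h
      · exact ⟨true, by simp, by simpa using h⟩
      · exact ⟨false, by simp, by simpa using h⟩)
  simpa using this

/-! ### Geometry of the cycle -/

section Geom

variable {k : ℕ} {G : HGraph k}

lemma card_eq_numE (hdvd : (k - 1) ∣ G.verts.card) : G.verts.card = numE G * (k - 1) :=
  (Nat.div_mul_cancel hdvd).symm

lemma pVerts_sub (H : LooseHamCycle k G) (hn : 0 < G.verts.card) (i t : ℕ) :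
    H.pVerts i t ⊆ G.verts := by
  intro v hv
  obtain ⟨r, _, rfl⟩ := Finset.mem_image.1 hv
  have h := Finset.mem_image_of_mem H.σ (Finset.mem_range.2 (Nat.mod_lt (i * (k - 1) + r) hn))
  rw [H.image_eq] at h
  exact h

lemma splitVerts_sub (H : LooseHamCycle k G) (hn : 0 < G.verts.card) (t : ℕ) (I : Finset ℕ) :
    splitVerts H t I ⊆ G.verts :=
  Finset.biUnion_subset.2 fun i _ => pVerts_sub H hn i t

lemma splitVerts_mono (H : LooseHamCycle k G) (t : ℕ) {I I' : Finset ℕ} (h : I ⊆ I') :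
    splitVerts H t I ⊆ splitVerts H t I' :=
  Finset.biUnion_subset_biUnion_of_subset_left _ h

lemma card_pVerts_le (H : LooseHamCycle k G) (i t : ℕ) : (H.pVerts i t).card ≤ TOf k t := by
  unfold LooseHamCycle.pVerts TOf
  exact Finset.card_image_le.trans (by simp)

lemma card_splitVerts_le (H : LooseHamCycle k G) (t : ℕ) (I : Finset ℕ) :
    (splitVerts H t I).card ≤ I.card * TOf k t :=
  Finset.card_biUnion_le_card_mul _ _ _ fun i _ => card_pVerts_le H i t

/-- indices of the paths containing `v` -/
def idx (H : LooseHamCycle k G) (t v : ℕ) : Finset ℕ :=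
  (Finset.range (numE G)).filter fun i => v ∈ H.pVerts i t

lemma add_mod_inj {n r a b : ℕ} (ha : a < n) (hb : b < n) (h : (a + r) % n = (b + r) % n) :
    a = b := by
  have : a ≡ b [MOD n] := Nat.ModEq.add_right_cancel' r h
  exact Nat.ModEq.eq_of_lt_of_lt this ha hb

lemma card_idx_le (H : LooseHamCycle k G) (hk : 2 ≤ k) (hdvd : (k - 1) ∣ G.verts.card)
    (hn : 0 < G.verts.card) (t v : ℕ) : (idx H t v).card ≤ TOf k t := by
  have h1 : idx H t v ⊆ (Finset.range (TOf k t)).biUnion fun r =>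
      (Finset.range (numE G)).filter fun i => H.σ ((i * (k - 1) + r) % G.verts.card) = v := by
    intro i hi
    obtain ⟨hi, hv⟩ := Finset.mem_filter.1 hi
    obtain ⟨r, hr, hv⟩ := Finset.mem_image.1 hv
    exact Finset.mem_biUnion.2 ⟨r, hr, Finset.mem_filter.2 ⟨hi, hv⟩⟩
  refine (Finset.card_le_card h1).trans ?_
  refine (Finset.card_biUnion_le_card_mul _ _ 1 ?_).trans (by simp)
  intro r _
  rw [Finset.card_le_one]
  intro a ha b hb
  simp only [Finset.mem_filter, Finset.mem_range] at ha hb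
  have h2 := H.injOn (Set.mem_Iio.2 (Nat.mod_lt _ hn)) (Set.mem_Iio.2 (Nat.mod_lt _ hn))
    (ha.2.trans hb.2.symm)
  have hc := card_eq_numE hdvd
  have hk1 : 0 < k - 1 := by omega
  have h3 := add_mod_inj (by rw [hc]; exact Nat.mul_lt_mul_of_pos_right ha.1 hk1)
    (by rw [hc]; exact Nat.mul_lt_mul_of_pos_right hb.1 hk1) h2
  exact Nat.eq_of_mul_eq_mul_right hk1 h3

lemma pos_shift (hdvd : (k - 1) ∣ G.verts.card) (a s : ℕ) :
    ((a % numE G) * (k - 1) + s) % G.verts.card = (a * (k - 1) + s) % G.verts.card := by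
  rw [card_eq_numE hdvd, ← Nat.mul_mod_mul_right, Nat.mod_add_mod]

lemma le_card_idx (H : LooseHamCycle k G) (hk : 2 ≤ k) (hdvd : (k - 1) ∣ G.verts.card)
    (hn : 0 < G.verts.card) (t v : ℕ) (hv : v ∈ G.verts) (ht : t ≤ numE G) :
    t ≤ (idx H t v).card := by
  rw [← H.image_eq] at hv
  obtain ⟨x, hx, rfl⟩ := Finset.mem_image.1 hv
  have hx := Finset.mem_range.1 hx
  have hk1 : 0 < k - 1 := by omega
  have hc := card_eq_numE hdvd
  have hN : 0 < numE G := by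
    rcases Nat.eq_zero_or_pos (numE G) with h | h
    · rw [h] at hc; omega
    · exact h
  have h1 : (Finset.range t).image (fun c => (x / (k - 1) + (numE G - c)) % numE G) ⊆
      idx H t (H.σ x) := by
    intro i hi
    obtain ⟨c, hc', rfl⟩ := Finset.mem_image.1 hi
    have hc' := Finset.mem_range.1 hc'
    refine Finset.mem_filter.2 ⟨Finset.mem_range.2 (Nat.mod_lt _ hN), ?_⟩
    have hs : x % (k - 1) < k - 1 := Nat.mod_lt _ hk1
    refine Finset.mem_image.2 ⟨c * (k - 1) + x % (k - 1), ?_, ?_⟩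
    · rw [Finset.mem_range]
      have : (c + 1) * (k - 1) ≤ t * (k - 1) := Nat.mul_le_mul_right _ hc'
      rw [add_mul] at this
      omega
    · rw [pos_shift hdvd]
      congr 1
      have e : (x / (k - 1) + (numE G - c)) * (k - 1) + (c * (k - 1) + x % (k - 1)) =
          x + G.verts.card := by
        have e1 : (x / (k - 1)) * (k - 1) + x % (k - 1) = x := by
          rw [mul_comm]; exact Nat.div_add_mod _ _
        have e2 : (numE G - c) * (k - 1) + c * (k - 1) = G.verts.card := by
          rw [hc, ← add_mul, Nat.sub_add_cancel (by omega)]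
        rw [add_mul]
        omega
      rw [e, Nat.add_mod_right, Nat.mod_eq_of_lt hx]
  have h2 : ((Finset.range t).image
      (fun c => (x / (k - 1) + (numE G - c)) % numE G)).card = t := by
    rw [Finset.card_image_of_injOn, Finset.card_range]
    intro c hc1 c' hc2 h
    have hc1 := Finset.mem_range.1 hc1
    have hc2 := Finset.mem_range.1 hc2
    have h : (numE G - c) ≡ (numE G - c') [MOD numE G] := Nat.ModEq.add_left_cancel' _ h
    have h3 : c + c' + (numE G - c) ≡ c + c' + (numE G - c') [MOD numE G] := h.add_left _
    have e1 : c + c' + (numE G - c) = c' + numE G := by omega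
    have e2 : c + c' + (numE G - c') = c + numE G := by omega
    rw [e1, e2] at h3
    have h4 := Nat.ModEq.add_right_cancel' _ h3
    exact (Nat.ModEq.eq_of_lt_of_lt h4 (by omega) (by omega)).symm
  calc t = _ := h2.symm
    _ ≤ _ := Finset.card_le_card h1

lemma numE_pos (hdvd : (k - 1) ∣ G.verts.card) (hn : 0 < G.verts.card) : 0 < numE G := by
  have hc := card_eq_numE hdvd
  rcases Nat.eq_zero_or_pos (numE G) with h | h
  · rw [h] at hc; omega
  · exact h

lemma cedge_eq (H : LooseHamCycle k G) (hk : 2 ≤ k) (i : ℕ) : H.cedge i = H.pVerts i 1 := by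
  unfold LooseHamCycle.cedge LooseHamCycle.pVerts
  rw [one_mul, Nat.sub_add_cancel (by omega)]

lemma mem_pVerts_cedge (H : LooseHamCycle k G) (hk : 2 ≤ k) (hdvd : (k - 1) ∣ G.verts.card)
    {i t u : ℕ} (hu : u ∈ H.pVerts i t) : ∃ a ≤ t, u ∈ H.cedge ((i + a) % numE G) := by
  obtain ⟨r, hr, rfl⟩ := Finset.mem_image.1 hu
  have hr := Finset.mem_range.1 hr
  have hk1 : 0 < k - 1 := by omega
  refine ⟨r / (k - 1), ?_, ?_⟩
  · apply Nat.div_le_of_le_mul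
    rw [mul_comm]; omega
  · refine Finset.mem_image.2 ⟨r % (k - 1), ?_, ?_⟩
    · have := Nat.mod_lt r hk1
      rw [Finset.mem_range]; omega
    · rw [pos_shift hdvd]
      congr 2
      rw [add_mul, add_assoc, mul_comm (r / (k - 1)), Nat.div_add_mod]

lemma close_symm {H : LooseHamCycle k G} {t u v : ℕ} (h : Close H t u v) : Close H t v u := by
  obtain ⟨i, hi, i', hi', hu, hv, d, hd, h⟩ := h
  exact ⟨i', hi', i, hi, hv, hu, d, hd, h.symm⟩

lemma close_of_same (H : LooseHamCycle k G) (hk : 2 ≤ k) (hdvd : (k - 1) ∣ G.verts.card)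
    (hn : 0 < G.verts.card) {i t u v : ℕ} (hu : u ∈ H.pVerts i t) (hv : v ∈ H.pVerts i t) :
    Close H t u v := by
  obtain ⟨a, ha, hu⟩ := mem_pVerts_cedge H hk hdvd hu
  obtain ⟨b, hb, hv⟩ := mem_pVerts_cedge H hk hdvd hv
  have hN := numE_pos hdvd hn
  refine ⟨_, Nat.mod_lt _ hN, _, Nat.mod_lt _ hN, hu, hv, ?_⟩
  rcases le_total a b with h | h
  · refine ⟨b - a, by omega, Or.inl ?_⟩
    rw [Nat.mod_add_mod]
    congr 1; omega
  · refine ⟨a - b, by omega, Or.inr ?_⟩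
    rw [Nat.mod_add_mod]
    congr 1; omega

/-- no path of length `t` contains two vertices of `B` -/
def FreeSet (H : LooseHamCycle k G) (t : ℕ) (B : Finset ℕ) : Prop :=
  ∀ u ∈ B, ∀ v ∈ B, ∀ i < numE G, u ∈ H.pVerts i t → v ∈ H.pVerts i t → u = v

lemma free_of_spread (H : LooseHamCycle k G) (hk : 2 ≤ k) (hdvd : (k - 1) ∣ G.verts.card)
    (hn : 0 < G.verts.card) {t : ℕ} {B : Finset ℕ} (h : SpreadSet H t B) : FreeSet H t B := by
  intro u hu v hv i _ h1 h2
  by_contra hne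
  exact h u hu v hv hne (close_of_same H hk hdvd hn h1 h2)

lemma free_mono {H : LooseHamCycle k G} {t : ℕ} {B B' : Finset ℕ} (h : FreeSet H t B)
    (hB : B' ⊆ B) : FreeSet H t B' :=
  fun u hu v hv => h u (hB hu) v (hB hv)

/-- choice functions -/
def chF (H : LooseHamCycle k G) (t : ℕ) (B : Finset ℕ) : Finset (B → ℕ) :=
  Fintype.piFinset fun v => idx H t v

lemma mem_chF {H : LooseHamCycle k G} {t : ℕ} {B : Finset ℕ} {φ : B → ℕ} :
    φ ∈ chF H t B ↔ ∀ v, φ v < numE G ∧ (v : ℕ) ∈ H.pVerts (φ v) t := by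
  simp [chF, idx]

lemma chF_inj {H : LooseHamCycle k G} {t : ℕ} {B : Finset ℕ} (hB : FreeSet H t B)
    {φ φ' : B → ℕ} (h : φ ∈ chF H t B) (h' : φ' ∈ chF H t B) {u v : B} (he : φ u = φ' v) :
    u = v := by
  rw [mem_chF] at h h'
  apply Subtype.ext
  refine hB u u.2 v v.2 (φ u) (h u).1 (h u).2 ?_
  rw [he]; exact (h' v).2

lemma chF_card {H : LooseHamCycle k G} {t : ℕ} {B : Finset ℕ} (hB : FreeSet H t B)
    {φ : B → ℕ} (h : φ ∈ chF H t B) : (Finset.univ.image φ).card = B.card := by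
  rw [Finset.card_image_of_injective _ (fun u v he => chF_inj hB h h he)]
  simp

lemma chF_exists (H : LooseHamCycle k G) {t : ℕ} {B S : Finset ℕ}
    (hS : S ⊆ Finset.range (numE G)) (h : B ⊆ splitVerts H t S) :
    ∃ φ ∈ chF H t B, Finset.univ.image φ ⊆ S := by
  have : ∀ v : B, ∃ i ∈ S, (v : ℕ) ∈ H.pVerts i t := fun v => by
    simpa [splitVerts] using h v.2
  choose φ h1 h2 using this
  refine ⟨φ, mem_chF.2 fun v => ⟨Finset.mem_range.1 (hS (h1 v)), h2 v⟩, ?_⟩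
  intro i hi
  obtain ⟨v, _, rfl⟩ := Finset.mem_image.1 hi
  exact h1 v

lemma chF_range {H : LooseHamCycle k G} {t : ℕ} {B : Finset ℕ}
    {φ : B → ℕ} (h : φ ∈ chF H t B) : Finset.univ.image φ ⊆ Finset.range (numE G) := by
  intro i hi
  obtain ⟨v, _, rfl⟩ := Finset.mem_image.1 hi
  exact Finset.mem_range.2 (mem_chF.1 h v).1

lemma chF_cover {H : LooseHamCycle k G} {t : ℕ} {B : Finset ℕ}
    {φ : B → ℕ} (h : φ ∈ chF H t B) : B ⊆ splitVerts H t (Finset.univ.image φ) := by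
  intro v hv
  exact Finset.mem_biUnion.2 ⟨φ ⟨v, hv⟩, Finset.mem_image_of_mem _ (Finset.mem_univ _),
    (mem_chF.1 h ⟨v, hv⟩).2⟩

lemma prob_cover_le (H : LooseHamCycle k G) (hk : 2 ≤ k) (hdvd : (k - 1) ∣ G.verts.card)
    (hn : 0 < G.verts.card) {t : ℕ} {B : Finset ℕ} (hB : FreeSet H t B) {p : ℝ} (h0 : 0 ≤ p)
    (h1 : p ≤ 1) :
    probOver (numE G) p (fun S => B ⊆ splitVerts H t S) ≤ (TOf k t * p) ^ B.card := by
  refine (probOver_union h0 h1 _ (chF H t B) (fun φ S => Finset.univ.image φ ⊆ S)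
    (fun S hS h => chF_exists H hS h)).trans ?_
  have : ∀ φ ∈ chF H t B, probOver (numE G) p (fun S => Finset.univ.image φ ⊆ S) =
      p ^ B.card := by
    intro φ hφ
    rw [probOver_sup _ (chF_range hφ), chF_card hB hφ]
  rw [Finset.sum_congr rfl this, Finset.sum_const, nsmul_eq_mul, mul_pow]
  apply mul_le_mul_of_nonneg_right _ (pow_nonneg h0 _)
  have h2 : (chF H t B).card ≤ TOf k t ^ B.card := by
    unfold chF
    rw [Fintype.card_piFinset]
    have := Finset.prod_le_pow_card (Finset.univ : Finset B) (fun v => (idx H t v).card) _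
      fun v _ => card_idx_le H hk hdvd hn t v
    simpa using this
  exact_mod_cast h2

lemma le_card_covers (H : LooseHamCycle k G) (hk : 2 ≤ k) (hdvd : (k - 1) ∣ G.verts.card)
    (hn : 0 < G.verts.card) {t q : ℕ} {B : Finset ℕ} (hB : FreeSet H t B) (hq : B.card = q)
    (hBv : B ⊆ G.verts) (ht : t ≤ numE G) :
    t ^ q ≤ ((Finset.powersetCard q (Finset.range (numE G))).filter
      fun A => B ⊆ splitVerts H t A).card := by
  have h1 : t ^ q ≤ (chF H t B).card := by
    unfold chF
    rw [Fintype.card_piFinset]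
    have := Finset.pow_card_le_prod (Finset.univ : Finset B) (fun v => (idx H t v).card) t
      (fun v _ => le_card_idx H hk hdvd hn t v (hBv v.2) ht)
    simpa [hq] using this
  refine h1.trans (Finset.card_le_card_of_injOn (fun φ => Finset.univ.image φ) ?_ ?_)
  · intro φ hφ
    have hφ : φ ∈ chF H t B := hφ
    rw [Finset.mem_coe, Finset.mem_filter, Finset.mem_powersetCard]
    exact ⟨⟨chF_range hφ, (chF_card hB hφ).trans hq⟩, chF_cover hφ⟩
  · intro φ hφ φ' hφ' he
    have he : Finset.univ.image φ = Finset.univ.image φ' := he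
    funext v
    have : φ v ∈ Finset.univ.image φ' := he ▸ Finset.mem_image_of_mem _ (Finset.mem_univ _)
    obtain ⟨u, _, hu⟩ := Finset.mem_image.1 this
    have := chF_inj hB hφ hφ' hu.symm
    rw [this] at hu ⊢
    exact hu.symm

/-! #### close paths -/

def PRel (H : LooseHamCycle k G) (t i i' : ℕ) : Prop :=
  ∃ u ∈ H.pVerts i t, ∃ v ∈ H.pVerts i' t, Close H t u v

lemma PRel_symm {H : LooseHamCycle k G} {t i i' : ℕ} (h : PRel H t i i') : PRel H t i' i := by
  obtain ⟨u, hu, v, hv, h⟩ := h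
  exact ⟨v, hv, u, hu, close_symm h⟩

def relSet (H : LooseHamCycle k G) (t i : ℕ) : Finset ℕ :=
  (Finset.range (numE G)).filter fun i' => PRel H t i i'

def DOf (k t : ℕ) : ℕ := TOf k t * (TOf k 1 * (((2 * t + 1) * 2) * (TOf k 1 * TOf k t)))

lemma card_relSet_le (H : LooseHamCycle k G) (hk : 2 ≤ k) (hdvd : (k - 1) ∣ G.verts.card)
    (hn : 0 < G.verts.card) (t i : ℕ) : (relSet H t i).card ≤ DOf k t := by
  set N := numE G with hN
  have hN0 : 0 < N := numE_pos hdvd hn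
  let near : ℕ → Finset ℕ := fun a => (Finset.range (2 * t + 1)).biUnion fun d =>
    {(a + d) % N} ∪ (Finset.range N).filter fun a' => (a' + d) % N = a
  have hnear : ∀ a, (near a).card ≤ (2 * t + 1) * 2 := by
    intro a
    refine (Finset.card_biUnion_le_card_mul _ _ 2 ?_).trans (by simp)
    intro d _
    refine (Finset.card_union_le _ _).trans ?_
    rw [Finset.card_singleton]
    have : ((Finset.range N).filter fun a' => (a' + d) % N = a).card ≤ 1 := by
      rw [Finset.card_le_one]
      intro x hx y hy
      simp only [Finset.mem_filter, Finset.mem_range] at hx hy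
      exact add_mod_inj hx.1 hy.1 (hx.2.trans hy.2.symm)
    omega
  have hsub : relSet H t i ⊆ (H.pVerts i t).biUnion fun u => (idx H 1 u).biUnion fun a =>
      (near a).biUnion fun a' => (H.pVerts a' 1).biUnion fun v => idx H t v := by
    intro i' hi'
    obtain ⟨hi', u, hu, v, hv, a, ha, a', ha', hua, hva, d, hd, h⟩ := Finset.mem_filter.1 hi'
    rw [cedge_eq H hk] at hua hva
    simp only [Finset.mem_biUnion]
    refine ⟨u, hu, a, Finset.mem_filter.2 ⟨Finset.mem_range.2 ha, hua⟩, a', ?_, v, hva,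
      Finset.mem_filter.2 ⟨hi', hv⟩⟩
    refine Finset.mem_biUnion.2 ⟨d, Finset.mem_range.2 (by omega), ?_⟩
    rw [Finset.mem_union]
    rcases h with h | h
    · left; rw [Finset.mem_singleton]; exact h.symm
    · right; exact Finset.mem_filter.2 ⟨Finset.mem_range.2 ha', h⟩
  refine (Finset.card_le_card hsub).trans ?_
  unfold DOf
  refine (Finset.card_biUnion_le_card_mul _ _ _ fun u _ =>
    (Finset.card_biUnion_le_card_mul _ _ _ fun a _ =>
      (Finset.card_biUnion_le_card_mul _ _ _ fun a' _ =>
        (Finset.card_biUnion_le_card_mul _ _ _ fun v _ =>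
          card_idx_le H hk hdvd hn t v).trans
            (Nat.mul_le_mul_right _ (card_pVerts_le H a' 1))).trans
          (Nat.mul_le_mul_right _ (hnear a))).trans
        (Nat.mul_le_mul_right _ (card_idx_le H hk hdvd hn 1 u))).trans
      (Nat.mul_le_mul_right _ (card_pVerts_le H i t))

def RelEvent (H : LooseHamCycle k G) (t i₀ : ℕ) (S : Finset ℕ) : Prop :=
  ∃ i ∈ insert i₀ S, ∃ i' ∈ insert i₀ S, i ≠ i' ∧ PRel H t i i'

lemma prob_rel_le (H : LooseHamCycle k G) (hk : 2 ≤ k) (hdvd : (k - 1) ∣ G.verts.card)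
    (hn : 0 < G.verts.card) (t i₀ : ℕ) {p : ℝ} (h0 : 0 ≤ p) (h1 : p ≤ 1) :
    probOver (numE G) p (RelEvent H t i₀) ≤ numE G * (DOf k t * p ^ 2) + DOf k t * p := by
  refine (probOver_or h0 h1 _
    (fun S => ∃ i ∈ S, ∃ i' ∈ S, i ≠ i' ∧ PRel H t i i')
    (fun S => ∃ i ∈ S, PRel H t i₀ i) ?_).trans ?_
  · rintro S hS ⟨i, hi, i', hi', hne, h⟩
    rcases Finset.mem_insert.1 hi with e | hi2
    · rcases Finset.mem_insert.1 hi' with e' | hi2'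
      · exact absurd (e.trans e'.symm) hne
      · exact Or.inr ⟨i', hi2', e ▸ h⟩
    · rcases Finset.mem_insert.1 hi' with e' | hi2'
      · exact Or.inr ⟨i, hi2, e' ▸ PRel_symm h⟩
      · exact Or.inl ⟨i, hi2, i', hi2', hne, h⟩
  have hD : ∀ i, ((relSet H t i).card : ℝ) ≤ DOf k t := fun i => by
    exact_mod_cast card_relSet_le H hk hdvd hn t i
  apply add_le_add
  · refine (probOver_union h0 h1 _ (Finset.range (numE G))
      (fun i S => ∃ i' ∈ (relSet H t i).erase i, {i, i'} ⊆ S) ?_).trans ?_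
    · rintro S hS ⟨i, hi, i', hi', hne, h⟩
      refine ⟨i, hS hi, i', Finset.mem_erase.2 ⟨hne.symm, Finset.mem_filter.2 ⟨hS hi', h⟩⟩, ?_⟩
      intro x hx
      simp only [Finset.mem_insert, Finset.mem_singleton] at hx
      rcases hx with rfl | rfl <;> assumption
    · rw [← nsmul_eq_mul, ← Finset.card_range (numE G)]
      simp only [Finset.card_range]
      refine (Finset.sum_le_card_nsmul _ _ (DOf k t * p ^ 2) ?_).trans (by simp)
      intro i hi
      refine (probOver_union h0 h1 _ ((relSet H t i).erase i)
        (fun i' S => {i, i'} ⊆ S) (fun S _ h => h)).trans ?_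
      have : ∀ i' ∈ (relSet H t i).erase i, probOver (numE G) p (fun S => {i, i'} ⊆ S) = p ^ 2 := by
        intro i' hi'
        obtain ⟨hne, hi'⟩ := Finset.mem_erase.1 hi'
        rw [probOver_sup, Finset.card_pair hne.symm]
        intro x hx
        simp only [Finset.mem_insert, Finset.mem_singleton] at hx
        rcases hx with rfl | rfl
        · exact hi
        · exact (Finset.mem_filter.1 hi').1
      rw [Finset.sum_congr rfl this, Finset.sum_const, nsmul_eq_mul]
      apply mul_le_mul_of_nonneg_right _ (by positivity)
      refine le_trans ?_ (hD i)
      exact_mod_cast Finset.card_le_card (Finset.erase_subset _ _)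
  · refine (probOver_union h0 h1 _ (relSet H t i₀) (fun i S => {i} ⊆ S) ?_).trans ?_
    · rintro S hS ⟨i, hi, h⟩
      exact ⟨i, Finset.mem_filter.2 ⟨hS hi, h⟩, by simpa using hi⟩
    · have : ∀ i' ∈ relSet H t i₀, probOver (numE G) p (fun S => {i'} ⊆ S) = p := by
        intro i' hi'
        rw [probOver_sup, Finset.card_singleton, pow_one]
        simpa using (Finset.mem_filter.1 hi').1
      rw [Finset.sum_congr rfl this, Finset.sum_const, nsmul_eq_mul]
      exact mul_le_mul_of_nonneg_right (hD i₀) h0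

end Geom

/-! ### The events -/

section Events

variable {k : ℕ} {G : HGraph k}

lemma card_edges_le (G : HGraph k) : G.edges.card ≤ G.verts.card ^ k := by
  have : G.edges ⊆ Finset.powersetCard k G.verts := fun e he =>
    Finset.mem_powersetCard.2 ⟨G.edge_sub e he, G.edge_card e he⟩
  refine (Finset.card_le_card this).trans ?_
  rw [Finset.card_powersetCard]
  exact Nat.choose_le_pow _ _

/-- E1 -/
lemma event1 (H : LooseHamCycle k G) (hk : 2 ≤ k) (hdvd : (k - 1) ∣ G.verts.card)
    (hn : 0 < G.verts.card) (χ : Finset ℕ → ℕ) (t i₀ : ℕ) {p b x : ℝ} (h0 : 0 ≤ p) (h1 : p ≤ 1)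
    (hb : 0 ≤ b) (hχ : GloballyBounded G χ b)
    (hx : ((TOf k t + k * (TOf k t * TOf k t) : ℕ) : ℝ) < x) :
    probOver (numE G) p (fun S => ∃ A ⊆ splitVerts H t S, A.card = k - 1 ∧ SpreadSet H t A ∧
      x ≤ (((G.inducedEdges (splitVerts H t (insert i₀ S))).filter
        fun e => A ⊆ e ∧ ∃ f ∈ H.cedges, χ f = χ e).card : ℝ)) ≤
      (G.verts.card * b) * (TOf k t * p) ^ k := by
  set F := G.edges.filter (fun e => FreeSet H t e ∧ ∃ f ∈ H.cedges, χ f = χ e) with hF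
  refine (probOver_union h0 h1 _ F (fun e S => e ⊆ splitVerts H t S) ?_).trans ?_
  · rintro S hS ⟨A, hA, hAc, hAs, hxA⟩
    by_contra hcon
    push Not at hcon
    set Q := (G.inducedEdges (splitVerts H t (insert i₀ S))).filter
        fun e => A ⊆ e ∧ ∃ f ∈ H.cedges, χ f = χ e with hQ
    have hAf := free_of_spread H hk hdvd hn hAs
    set W := H.pVerts i₀ t ∪ A.biUnion fun a => (idx H t a).biUnion fun i => H.pVerts i t with hW
    have hsub : Q ⊆ W.image fun v => insert v A := by
      intro e he
      obtain ⟨he, hAe, hf⟩ := Finset.mem_filter.1 he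
      obtain ⟨heE, heV⟩ := Finset.mem_filter.1 he
      have hec := G.edge_card e heE
      have : (e \ A).card = 1 := by
        rw [Finset.card_sdiff_of_subset hAe]; omega
      obtain ⟨v, hv⟩ := Finset.card_eq_one.1 this
      have hev : e = insert v A := by
        rw [← Finset.sdiff_union_of_subset hAe, hv]; rfl
      refine Finset.mem_image.2 ⟨v, ?_, hev.symm⟩
      by_contra hvW
      rw [hW, Finset.mem_union, not_or] at hvW
      obtain ⟨hv0, hvA⟩ := hvW
      have hvA' : ∀ a ∈ A, ∀ i < numE G, a ∈ H.pVerts i t → v ∉ H.pVerts i t := by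
        intro a ha i hi h1 h2
        apply hvA
        simp only [Finset.mem_biUnion]
        exact ⟨a, ha, i, Finset.mem_filter.2 ⟨Finset.mem_range.2 hi, h1⟩, h2⟩
      have hfree : FreeSet H t e := by
        rw [hev]
        intro u hu w hw i hi h1 h2
        rcases Finset.mem_insert.1 hu with e1 | e1 <;> rcases Finset.mem_insert.1 hw with e2 | e2
        · rw [e1, e2]
        · exact absurd (e1 ▸ h1) (hvA' w e2 i hi h2)
        · exact absurd (e2 ▸ h2) (hvA' u e1 i hi h1)
        · exact hAf u e1 w e2 i hi h1 h2
      refine hcon e (Finset.mem_filter.2 ⟨heE, hfree, hf⟩) ?_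
      rw [hev]
      intro u hu
      rcases Finset.mem_insert.1 hu with e1 | e1
      · have : v ∈ splitVerts H t (insert i₀ S) := heV (by rw [hev]; simp)
        unfold splitVerts at this ⊢
        rw [Finset.biUnion_insert, Finset.mem_union] at this
        rw [e1]
        exact this.resolve_left hv0
      · exact hA e1
    have hc : Q.card ≤ TOf k t + k * (TOf k t * TOf k t) := by
      refine (Finset.card_le_card hsub).trans (Finset.card_image_le.trans ?_)
      refine (Finset.card_union_le _ _).trans (add_le_add (card_pVerts_le _ _ _) ?_)
      refine (Finset.card_biUnion_le_card_mul _ _ _ fun a _ =>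
        (Finset.card_biUnion_le_card_mul _ _ _ fun i _ => card_pVerts_le H i t).trans
          (Nat.mul_le_mul_right _ (card_idx_le H hk hdvd hn t a))).trans ?_
      apply Nat.mul_le_mul_right
      omega
    have : (Q.card : ℝ) ≤ ((TOf k t + k * (TOf k t * TOf k t) : ℕ) : ℝ) := by exact_mod_cast hc
    linarith
  · have hFc : (F.card : ℝ) ≤ G.verts.card * b := by
      have hs : F ⊆ H.cedges.biUnion fun f => G.edges.filter fun e => χ e = χ f := by
        intro e he
        obtain ⟨he, _, f, hf, h⟩ := Finset.mem_filter.1 he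
        exact Finset.mem_biUnion.2 ⟨f, hf, Finset.mem_filter.2 ⟨he, h.symm⟩⟩
      have hc1 : (F.card : ℝ) ≤ ∑ f ∈ H.cedges, ((G.edges.filter fun e => χ e = χ f).card : ℝ) := by
        exact_mod_cast (Finset.card_le_card hs).trans Finset.card_biUnion_le
      refine hc1.trans ((Finset.sum_le_card_nsmul _ _ b fun f _ => hχ (χ f)).trans ?_)
      rw [nsmul_eq_mul]
      apply mul_le_mul_of_nonneg_right _ hb
      have : H.cedges.card ≤ G.verts.card := by
        unfold LooseHamCycle.cedges
        refine Finset.card_image_le.trans ?_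
        rw [Finset.card_range]
        exact Nat.div_le_self _ _
      exact_mod_cast this
    have hT : 0 ≤ ((TOf k t : ℝ) * p) ^ k := by positivity
    refine (Finset.sum_le_card_nsmul F _ ((TOf k t * p) ^ k) ?_).trans ?_
    · intro e he
      obtain ⟨he, hfree, _⟩ := Finset.mem_filter.1 he
      have := prob_cover_le H hk hdvd hn hfree h0 h1
      rwa [G.edge_card e he] at this
    · rw [nsmul_eq_mul]
      exact mul_le_mul_of_nonneg_right hFc hT

/-- E2 and E3 -/
lemma event23 (H : LooseHamCycle k G) (hk : 2 ≤ k) (hdvd : (k - 1) ∣ G.verts.card)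
    (hn : 0 < G.verts.card) (χ : Finset ℕ → ℕ) (t : ℕ) {p b : ℝ} (h0 : 0 ≤ p) (h1 : p ≤ 1)
    (hχ : GloballyBounded G χ b) (P : Finset ℕ → Prop)
    (hP : ∀ S ⊆ Finset.range (numE G), P S → ∃ e ∈ G.edges, ∃ f ∈ G.edges, χ e = χ f ∧
      e ∪ f ⊆ splitVerts H t S ∧ ∃ B ⊆ e ∪ f, B.card = 2 * k - 1 ∧ FreeSet H t B) :
    probOver (numE G) p P ≤
      ((G.verts.card : ℝ) ^ k * b) * (TOf k t * p) ^ (2 * k - 1) := by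
  set F := (G.edges ×ˢ G.edges).filter (fun x => χ x.1 = χ x.2 ∧
    ∃ B ⊆ x.1 ∪ x.2, B.card = 2 * k - 1 ∧ FreeSet H t B) with hF
  have hb : 0 ≤ b := le_trans (Nat.cast_nonneg _) (hχ 0)
  refine (probOver_union h0 h1 _ F (fun x S => x.1 ∪ x.2 ⊆ splitVerts H t S) ?_).trans ?_
  · intro S hS h
    obtain ⟨e, he, f, hf, hc, hsub, hB⟩ := hP S hS h
    exact ⟨(e, f), Finset.mem_filter.2 ⟨Finset.mem_product.2 ⟨he, hf⟩, hc, hB⟩, hsub⟩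
  · have hFc : (F.card : ℝ) ≤ (G.verts.card : ℝ) ^ k * b := by
      have hs : F ⊆ G.edges.biUnion fun e => (G.edges.filter fun f => χ f = χ e).image
          fun f => (e, f) := by
        rintro ⟨e, f⟩ he
        obtain ⟨he, hc, _⟩ := Finset.mem_filter.1 he
        obtain ⟨he, hf⟩ := Finset.mem_product.1 he
        exact Finset.mem_biUnion.2 ⟨e, he, Finset.mem_image_of_mem _
          (Finset.mem_filter.2 ⟨hf, hc.symm⟩)⟩
      have hc1 : (F.card : ℝ) ≤ ∑ e ∈ G.edges, ((G.edges.filter fun f => χ f = χ e).card : ℝ) := by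
        have := (Finset.card_le_card hs).trans (Finset.card_biUnion_le.trans
          (Finset.sum_le_sum fun e _ => Finset.card_image_le))
        exact_mod_cast this
      refine hc1.trans ((Finset.sum_le_card_nsmul _ _ b fun f _ => hχ (χ f)).trans ?_)
      rw [nsmul_eq_mul]
      apply mul_le_mul_of_nonneg_right _ hb
      exact_mod_cast card_edges_le G
    refine (Finset.sum_le_card_nsmul F _ ((TOf k t * p) ^ (2 * k - 1)) ?_).trans ?_
    · rintro ⟨e, f⟩ he
      obtain ⟨_, _, B, hB, hBc, hfree⟩ := Finset.mem_filter.1 he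
      have := prob_cover_le H hk hdvd hn hfree h0 h1
      rw [hBc] at this
      exact (probOver_mono h0 h1 _ _ fun S _ h => hB.trans h).trans this
    · rw [nsmul_eq_mul]
      exact mul_le_mul_of_nonneg_right hFc (by positivity)

lemma event2_hyp (H : LooseHamCycle k G) (hk : 2 ≤ k) (hdvd : (k - 1) ∣ G.verts.card)
    (hn : 0 < G.verts.card) (χ : Finset ℕ → ℕ) (t : ℕ) (S : Finset ℕ)
    (h : ∃ e ∈ G.edges, ∃ f ∈ G.edges, e ≠ f ∧ χ e = χ f ∧
      (e ∩ f).card ≤ 1 ∧ SpreadSet H t (e ∪ f) ∧ e ∪ f ⊆ splitVerts H t S) :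
    ∃ e ∈ G.edges, ∃ f ∈ G.edges, χ e = χ f ∧
      e ∪ f ⊆ splitVerts H t S ∧ ∃ B ⊆ e ∪ f, B.card = 2 * k - 1 ∧ FreeSet H t B := by
  obtain ⟨e, he, f, hf, _, hc, hi, hs, hsub⟩ := h
  have hu := Finset.card_union_add_card_inter e f
  rw [G.edge_card e he, G.edge_card f hf] at hu
  obtain ⟨B, hB, hBc⟩ := Finset.exists_subset_card_eq (s := e ∪ f) (n := 2 * k - 1) (by omega)
  exact ⟨e, he, f, hf, hc, hsub, B, hB, hBc, free_mono (free_of_spread H hk hdvd hn hs) hB⟩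

lemma event3_hyp (H : LooseHamCycle k G) (hk : 2 ≤ k) (hdvd : (k - 1) ∣ G.verts.card)
    (hn : 0 < G.verts.card) (χ : Finset ℕ → ℕ) (t : ℕ) (S : Finset ℕ)
    (h : ∃ e ∈ G.edges, ∃ f ∈ G.edges, χ e = χ f ∧ Disjoint e f ∧
      AlmostSpreadSet H t (e ∪ f) ∧ e ∪ f ⊆ splitVerts H t S) :
    ∃ e ∈ G.edges, ∃ f ∈ G.edges, χ e = χ f ∧
      e ∪ f ⊆ splitVerts H t S ∧ ∃ B ⊆ e ∪ f, B.card = 2 * k - 1 ∧ FreeSet H t B := by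
  obtain ⟨e, he, f, hf, hc, hd, ⟨u, hu, v, hv, huv, hcl, hall⟩, hsub⟩ := h
  have hcard := Finset.card_union_of_disjoint hd
  rw [G.edge_card e he, G.edge_card f hf] at hcard
  refine ⟨e, he, f, hf, hc, hsub, (e ∪ f).erase u, Finset.erase_subset _ _, ?_, ?_⟩
  · rw [Finset.card_erase_of_mem hu]; omega
  · apply free_of_spread H hk hdvd hn
    intro a ha b hb hab hcl'
    obtain ⟨ha1, ha2⟩ := Finset.mem_erase.1 ha
    obtain ⟨hb1, hb2⟩ := Finset.mem_erase.1 hb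
    have := hall a ha2 b hb2 hab hcl'
    have hu' : u ∈ ({a, b} : Finset ℕ) := by rw [this]; simp
    simp only [Finset.mem_insert, Finset.mem_singleton] at hu'
    rcases hu' with h | h
    · exact ha1 h.symm
    · exact hb1 h.symm

/-! #### E4 -/

lemma sum_small (U : Finset ℕ) {p y : ℝ} (h0 : 0 ≤ p) (hy : 1 ≤ y) (hp : U.card * p ≤ y) (r : ℕ) :
    ∑ E ∈ U.powerset.filter (fun E => E.card ≤ r), p ^ E.card ≤ (r + 1) * y ^ r := by
  have hs : U.powerset.filter (fun E => E.card ≤ r) ⊆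
      (Finset.range (r + 1)).biUnion fun l => Finset.powersetCard l U := by
    intro E hE
    obtain ⟨h1, h2⟩ := Finset.mem_filter.1 hE
    exact Finset.mem_biUnion.2 ⟨E.card, Finset.mem_range.2 (by omega),
      Finset.mem_powersetCard.2 ⟨Finset.mem_powerset.1 h1, rfl⟩⟩
  refine (Finset.sum_le_sum_of_subset_of_nonneg hs (fun _ _ _ => by positivity)).trans ?_
  rw [Finset.sum_biUnion]
  · refine (Finset.sum_le_card_nsmul _ _ (y ^ r) ?_).trans (by simp)
    intro l hl
    have hl := Finset.mem_range.1 hl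
    have : ∀ E ∈ Finset.powersetCard l U, p ^ E.card = p ^ l := fun E hE => by
      rw [(Finset.mem_powersetCard.1 hE).2]
    rw [Finset.sum_congr rfl this, Finset.sum_const, nsmul_eq_mul, Finset.card_powersetCard]
    have h2 : ((U.card.choose l : ℕ) : ℝ) ≤ (U.card : ℝ) ^ l := by
      exact_mod_cast Nat.choose_le_pow _ _
    calc _ ≤ (U.card : ℝ) ^ l * p ^ l := mul_le_mul_of_nonneg_right h2 (by positivity)
      _ = (U.card * p) ^ l := (mul_pow _ _ _).symm
      _ ≤ y ^ l := by gcongr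
      _ ≤ y ^ r := pow_le_pow_right₀ hy (by omega)
  · intro a _ b _ hab
    exact Finset.pairwise_disjoint_powersetCard U hab

lemma sum_pairs (U : Finset ℕ) {p y : ℝ} (h0 : 0 ≤ p) (hy : 1 ≤ y) (hp : U.card * p ≤ y) (q : ℕ)
    (hq : 1 ≤ q) :
    ∑ A ∈ Finset.powersetCard q U, ∑ B ∈ (Finset.powersetCard q U).filter
      (fun B => ¬ Disjoint A B), p ^ (A ∪ B).card ≤ 2 ^ q * q * y ^ (2 * q - 1) := by
  have inner : ∀ A ∈ Finset.powersetCard q U, ∑ B ∈ (Finset.powersetCard q U).filter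
      (fun B => ¬ Disjoint A B), p ^ (A ∪ B).card ≤ p ^ q * (2 ^ q * (q * y ^ (q - 1))) := by
    intro A hA
    obtain ⟨hAU, hAq⟩ := Finset.mem_powersetCard.1 hA
    have e1 : ∀ B ∈ (Finset.powersetCard q U).filter (fun B => ¬ Disjoint A B),
        p ^ (A ∪ B).card = p ^ q * p ^ (B \ A).card := by
      intro B _
      rw [← pow_add, ← Finset.union_sdiff_self_eq_union,
        Finset.card_union_of_disjoint Finset.disjoint_sdiff, hAq]
    rw [Finset.sum_congr rfl e1, ← Finset.mul_sum]
    apply mul_le_mul_of_nonneg_left _ (by positivity)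
    set Fm := (Finset.powersetCard q U).filter (fun B => ¬ Disjoint A B) with hFm
    set V := U.powerset.filter (fun E => E.card ≤ q - 1) with hV
    have hmaps : ∀ B ∈ Fm, (B ∩ A, B \ A) ∈ A.powerset ×ˢ V := by
      intro B hB
      obtain ⟨hB, hd⟩ := Finset.mem_filter.1 hB
      obtain ⟨hBU, hBq⟩ := Finset.mem_powersetCard.1 hB
      refine Finset.mem_product.2 ⟨Finset.mem_powerset.2 Finset.inter_subset_right,
        Finset.mem_filter.2 ⟨Finset.mem_powerset.2 (Finset.sdiff_subset.trans hBU), ?_⟩⟩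
      have h2 := Finset.card_sdiff_add_card_inter B A
      have h3 : 0 < (B ∩ A).card := by
        rw [Finset.card_pos]
        rw [disjoint_comm] at hd
        exact Finset.not_disjoint_iff_nonempty_inter.1 hd
      simp only
      omega
    have hinj : Set.InjOn (fun B => (B ∩ A, B \ A)) (Fm : Set (Finset ℕ)) := by
      intro B _ B' _ h
      simp only [Prod.mk.injEq] at h
      rw [← Finset.sdiff_union_inter B A, ← Finset.sdiff_union_inter B' A, h.1, h.2]
    calc ∑ B ∈ Fm, p ^ (B \ A).card
        = ∑ x ∈ Fm.image (fun B => (B ∩ A, B \ A)), p ^ x.2.card := by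
          rw [Finset.sum_image hinj]
      _ ≤ ∑ x ∈ A.powerset ×ˢ V, p ^ x.2.card := by
          apply Finset.sum_le_sum_of_subset_of_nonneg
          · exact Finset.image_subset_iff.2 hmaps
          · intros; positivity
      _ = 2 ^ q * ∑ E ∈ V, p ^ E.card := by
          rw [Finset.sum_product]
          simp [Finset.card_powerset, hAq]
      _ ≤ _ := by
          apply mul_le_mul_of_nonneg_left _ (by positivity)
          have := sum_small U h0 hy hp (q - 1)
          have e : ((q - 1 : ℕ) : ℝ) + 1 = q := by
            rw [Nat.cast_sub hq]; simp
          rwa [e] at this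
  refine (Finset.sum_le_card_nsmul _ _ _ inner).trans ?_
  rw [nsmul_eq_mul, Finset.card_powersetCard]
  have h2 : ((U.card.choose q : ℕ) : ℝ) ≤ (U.card : ℝ) ^ q := by
    exact_mod_cast Nat.choose_le_pow _ _
  have hyn : 0 ≤ y := by linarith
  calc _ ≤ (U.card : ℝ) ^ q * (p ^ q * (2 ^ q * (q * y ^ (q - 1)))) :=
        mul_le_mul_of_nonneg_right h2 (by positivity)
    _ = (U.card * p) ^ q * (2 ^ q * (q * y ^ (q - 1))) := by rw [mul_pow]; ring
    _ ≤ y ^ q * (2 ^ q * (q * y ^ (q - 1))) := by gcongr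
    _ = 2 ^ q * q * (y ^ q * y ^ (q - 1)) := by ring
    _ = _ := by rw [← pow_add]; congr 2; omega

/-- free link sets -/
def linkF (H : LooseHamCycle k G) (t q : ℕ) (T : Finset ℕ) : Finset (Finset ℕ) :=
  (Finset.powersetCard q G.verts).filter fun B => Disjoint T B ∧ T ∪ B ∈ G.edges ∧ FreeSet H t B

def wF (H : LooseHamCycle k G) (t q : ℕ) (T A : Finset ℕ) : ℝ :=
  (((linkF H t q T).filter fun B => B ⊆ splitVerts H t A).card : ℝ)

lemma card_bad (H : LooseHamCycle k G) (hk : 2 ≤ k) (hdvd : (k - 1) ∣ G.verts.card)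
    (hn : 0 < G.verts.card) (t q : ℕ) :
    ((Finset.powersetCard q G.verts).filter fun B => ¬ FreeSet H t B).card ≤
      TOf k t * TOf k t * G.verts.card ^ (q - 1) := by
  set Bd := (Finset.powersetCard q G.verts).filter fun B => ¬ FreeSet H t B with hBd
  rcases Finset.eq_empty_or_nonempty Bd with h | ⟨B, hB⟩
  · rw [h]; simp
  have hq : 2 ≤ q := by
    obtain ⟨hB, hf⟩ := Finset.mem_filter.1 hB
    unfold FreeSet at hf
    push Not at hf
    obtain ⟨u, hu, v, hv, i, hi, h1, h2, hne⟩ := hf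
    rw [← (Finset.mem_powersetCard.1 hB).2]
    exact Finset.one_lt_card.2 ⟨u, hu, v, hv, hne⟩
  have hs : Bd ⊆ G.verts.biUnion fun u => (idx H t u).biUnion fun i => (H.pVerts i t).biUnion
      fun v => (Finset.powersetCard (q - 2) G.verts).image fun C => insert u (insert v C) := by
    intro B hB
    obtain ⟨hB, hf⟩ := Finset.mem_filter.1 hB
    obtain ⟨hBv, hBq⟩ := Finset.mem_powersetCard.1 hB
    unfold FreeSet at hf
    push Not at hf
    obtain ⟨u, hu, v, hv, i, hi, h1, h2, hne⟩ := hf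
    simp only [Finset.mem_biUnion]
    have hv' : v ∈ B.erase u := Finset.mem_erase.2 ⟨fun h => hne h.symm, hv⟩
    refine ⟨u, hBv hu, i, Finset.mem_filter.2 ⟨Finset.mem_range.2 hi, h1⟩, v, h2,
      Finset.mem_image.2 ⟨(B.erase u).erase v, ?_, ?_⟩⟩
    · refine Finset.mem_powersetCard.2 ⟨((Finset.erase_subset _ _).trans
        (Finset.erase_subset _ _)).trans hBv, ?_⟩
      rw [Finset.card_erase_of_mem hv', Finset.card_erase_of_mem hu]; omega
    · rw [Finset.insert_erase hv', Finset.insert_erase hu]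
  refine (Finset.card_le_card hs).trans ?_
  refine (Finset.card_biUnion_le_card_mul _ _ (TOf k t * (TOf k t * G.verts.card ^ (q - 2)))
    fun u _ => (Finset.card_biUnion_le_card_mul _ _ (TOf k t * G.verts.card ^ (q - 2)) fun i _ =>
      (Finset.card_biUnion_le_card_mul _ _ (G.verts.card ^ (q - 2)) fun v _ => ?_).trans
        (Nat.mul_le_mul_right _ (card_pVerts_le H i t))).trans
        (Nat.mul_le_mul_right _ (card_idx_le H hk hdvd hn t u))).trans ?_
  · refine Finset.card_image_le.trans ?_
    rw [Finset.card_powersetCard]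
    exact Nat.choose_le_pow _ _
  · have : q - 1 = (q - 2) + 1 := by omega
    rw [this, pow_succ]
    apply le_of_eq; ring

lemma card_linkF (H : LooseHamCycle k G) (hk : 2 ≤ k) (hdvd : (k - 1) ∣ G.verts.card)
    (hn : 0 < G.verts.card) (t q : ℕ) (T : Finset ℕ) (hT : T.card + q = k) :
    G.degOn T ≤ (linkF H t q T).card + TOf k t * TOf k t * G.verts.card ^ (q - 1) := by
  refine le_trans ?_ (Nat.add_le_add_left (card_bad H hk hdvd hn t q) _)
  refine le_trans ?_ (Finset.card_union_le _ _)
  refine Finset.card_le_card_of_injOn (fun e => e \ T) ?_ ?_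
  · intro e he
    obtain ⟨he, hTe⟩ := Finset.mem_filter.1 (Finset.mem_coe.1 he)
    have h1 : e \ T ∈ Finset.powersetCard q G.verts := by
      refine Finset.mem_powersetCard.2 ⟨Finset.sdiff_subset.trans (G.edge_sub e he), ?_⟩
      rw [Finset.card_sdiff_of_subset hTe, G.edge_card e he]; omega
    rw [Finset.mem_coe, Finset.mem_union]
    by_cases hf : FreeSet H t (e \ T)
    · left
      refine Finset.mem_filter.2 ⟨h1, Finset.disjoint_sdiff, ?_, hf⟩
      rw [Finset.union_sdiff_of_subset hTe]; exact he
    · right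
      exact Finset.mem_filter.2 ⟨h1, hf⟩
  · intro e he e' he' h
    obtain ⟨_, hTe⟩ := Finset.mem_filter.1 (Finset.mem_coe.1 he)
    obtain ⟨_, hTe'⟩ := Finset.mem_filter.1 (Finset.mem_coe.1 he')
    have h : e \ T = e' \ T := h
    rw [← Finset.union_sdiff_of_subset hTe, ← Finset.union_sdiff_of_subset hTe', h]

lemma wF_le (H : LooseHamCycle k G) (t q : ℕ) (T A : Finset ℕ) (hA : A.card = q) :
    wF H t q T A ≤ ((q : ℝ) * TOf k t) ^ q := by
  unfold wF
  have : (linkF H t q T).filter (fun B => B ⊆ splitVerts H t A) ⊆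
      Finset.powersetCard q (splitVerts H t A) := by
    intro B hB
    obtain ⟨h1, h2⟩ := Finset.mem_filter.1 hB
    exact Finset.mem_powersetCard.2 ⟨h2,
      (Finset.mem_powersetCard.1 (Finset.mem_filter.1 h1).1).2⟩
  have h2 := Finset.card_le_card this
  rw [Finset.card_powersetCard] at h2
  have h3 : ((splitVerts H t A).card).choose q ≤ (q * TOf k t) ^ q := by
    refine (Nat.choose_le_pow _ _).trans (Nat.pow_le_pow_left ?_ q)
    rw [← hA]
    exact card_splitVerts_le H t A
  exact_mod_cast h2.trans h3

lemma mean_ge (H : LooseHamCycle k G) (hk : 2 ≤ k) (hdvd : (k - 1) ∣ G.verts.card)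
    (hn : 0 < G.verts.card) (t q : ℕ) (T : Finset ℕ) (ht : t ≤ numE G) {p : ℝ} (h0 : 0 ≤ p) :
    ((linkF H t q T).card : ℝ) * (t * p) ^ q ≤
      ∑ A ∈ Finset.powersetCard q (Finset.range (numE G)), wF H t q T A * p ^ A.card := by
  have e1 : ∀ A ∈ Finset.powersetCard q (Finset.range (numE G)),
      wF H t q T A * p ^ A.card = wF H t q T A * p ^ q := by
    intro A hA
    rw [(Finset.mem_powersetCard.1 hA).2]
  rw [Finset.sum_congr rfl e1, ← Finset.sum_mul, mul_pow, ← mul_assoc]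
  apply mul_le_mul_of_nonneg_right _ (by positivity)
  have h := Finset.sum_card_bipartiteAbove_eq_sum_card_bipartiteBelow
    (s := Finset.powersetCard q (Finset.range (numE G))) (t := linkF H t q T)
    (fun A B => B ⊆ splitVerts H t A)
  unfold wF
  have h2 : (linkF H t q T).card * t ^ q ≤ ∑ B ∈ linkF H t q T,
      ((Finset.powersetCard q (Finset.range (numE G))).filter
        fun A => B ⊆ splitVerts H t A).card := by
    rw [← smul_eq_mul]
    apply Finset.card_nsmul_le_sum
    intro B hB
    obtain ⟨h1, _, _, hf⟩ := Finset.mem_filter.1 hB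
    obtain ⟨hBv, hBq⟩ := Finset.mem_powersetCard.1 h1
    exact le_card_covers H hk hdvd hn hf hBq hBv ht
  unfold Finset.bipartiteAbove Finset.bipartiteBelow at h
  rw [← h] at h2
  exact_mod_cast h2

lemma XW_le_deg (H : LooseHamCycle k G) (hk : 2 ≤ k) (hdvd : (k - 1) ∣ G.verts.card)
    (hn : 0 < G.verts.card) (t q i₀ : ℕ) (T S : Finset ℕ) (hS : S ⊆ Finset.range (numE G))
    (hT : T ⊆ splitVerts H t (insert i₀ S)) (hrel : ¬ RelEvent H t i₀ S) :
    XW (Finset.powersetCard q (Finset.range (numE G))) (wF H t q T) S ≤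
      (((G.inducedEdges (splitVerts H t (insert i₀ S))).filter fun e => T ⊆ e).card : ℝ) := by
  have hdisj : ∀ i ∈ S, ∀ i' ∈ S, ∀ v, v ∈ H.pVerts i t → v ∈ H.pVerts i' t → i = i' := by
    intro i hi i' hi' v hv hv'
    by_contra hne
    exact hrel ⟨i, Finset.mem_insert_of_mem hi, i', Finset.mem_insert_of_mem hi', hne, v, hv, v,
      hv', close_of_same H hk hdvd hn hv hv⟩
  have e1 : XW (Finset.powersetCard q (Finset.range (numE G))) (wF H t q T) S =
      ∑ A ∈ Finset.powersetCard q S, wF H t q T A := by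
    unfold XW
    have : Finset.powersetCard q S =
        (Finset.powersetCard q (Finset.range (numE G))).filter fun A => A ⊆ S := by
      ext A
      simp only [Finset.mem_powersetCard, Finset.mem_filter]
      constructor
      · rintro ⟨h1, h2⟩; exact ⟨⟨h1.trans hS, h2⟩, h1⟩
      · rintro ⟨⟨_, h2⟩, h1⟩; exact ⟨h1, h2⟩
    rw [this, Finset.sum_filter]
    apply Finset.sum_congr rfl
    intro A _
    unfold ind
    split_ifs <;> simp
  rw [e1]
  unfold wF
  rw [← Nat.cast_sum, Nat.cast_le, ← Finset.card_biUnion]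
  · refine Finset.card_le_card_of_injOn (fun B => T ∪ B) ?_ ?_
    · intro B hB
      obtain ⟨A, hA, hB⟩ := Finset.mem_biUnion.1 (Finset.mem_coe.1 hB)
      obtain ⟨hB, hBA⟩ := Finset.mem_filter.1 hB
      obtain ⟨_, _, hE, _⟩ := Finset.mem_filter.1 hB
      have hAS := (Finset.mem_powersetCard.1 hA).1
      refine Finset.mem_coe.2 (Finset.mem_filter.2 ⟨Finset.mem_filter.2 ⟨hE,
        Finset.union_subset hT (hBA.trans (splitVerts_mono H t
          (hAS.trans (Finset.subset_insert _ _))))⟩, Finset.subset_union_left⟩)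
    · intro B hB B' hB' h
      obtain ⟨A, hA, hB⟩ := Finset.mem_biUnion.1 (Finset.mem_coe.1 hB)
      obtain ⟨A', hA', hB'⟩ := Finset.mem_biUnion.1 (Finset.mem_coe.1 hB')
      have hd := (Finset.mem_filter.1 (Finset.mem_filter.1 hB).1).2.1
      have hd' := (Finset.mem_filter.1 (Finset.mem_filter.1 hB').1).2.1
      have h : T ∪ B = T ∪ B' := h
      rw [← Finset.union_sdiff_cancel_left hd, h, Finset.union_sdiff_cancel_left hd']
  · intro A hA A' hA' hne
    rw [Function.onFun, Finset.disjoint_left]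
    intro B hB hB'
    apply hne
    obtain ⟨hBl, hBA⟩ := Finset.mem_filter.1 hB
    obtain ⟨_, hBA'⟩ := Finset.mem_filter.1 hB'
    obtain ⟨hBp, _, _, hf⟩ := Finset.mem_filter.1 hBl
    have hBq := (Finset.mem_powersetCard.1 hBp).2
    obtain ⟨hAS, hAq⟩ := Finset.mem_powersetCard.1 hA
    obtain ⟨hAS', hAq'⟩ := Finset.mem_powersetCard.1 hA'
    obtain ⟨φ, hφ, hφA⟩ := chF_exists H (hAS.trans hS) hBA
    obtain ⟨φ', hφ', hφA'⟩ := chF_exists H (hAS'.trans hS) hBA'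
    have h1 : Finset.univ.image φ = A :=
      Finset.eq_of_subset_of_card_le hφA (by rw [chF_card hf hφ]; omega)
    have h2 : Finset.univ.image φ' = A' :=
      Finset.eq_of_subset_of_card_le hφA' (by rw [chF_card hf hφ']; omega)
    have h3 : φ = φ' := by
      funext v
      exact hdisj _ (hAS (hφA (Finset.mem_image_of_mem _ (Finset.mem_univ _)))) _
        (hAS' (hφA' (Finset.mem_image_of_mem _ (Finset.mem_univ _)))) v
        (mem_chF.1 hφ v).2 (mem_chF.1 hφ' v).2
    rw [← h1, ← h2, h3]

lemma exists_small (H : LooseHamCycle k G) (t i₀ : ℕ) (T S : Finset ℕ)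
    (hT : T ⊆ splitVerts H t (insert i₀ S)) :
    ∃ J ⊆ S, J.card ≤ T.card ∧ T ⊆ splitVerts H t (insert i₀ J) := by
  set T' := T.filter fun v => v ∉ H.pVerts i₀ t with hT'
  have : ∀ v : T', ∃ i ∈ S, (v : ℕ) ∈ H.pVerts i t := by
    intro v
    obtain ⟨h1, h2⟩ := Finset.mem_filter.1 v.2
    have := hT h1
    unfold splitVerts at this
    rw [Finset.biUnion_insert, Finset.mem_union] at this
    simpa using this.resolve_left h2
  choose φ h1 h2 using this
  refine ⟨Finset.univ.image φ, ?_, ?_, ?_⟩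
  · intro i hi
    obtain ⟨v, _, rfl⟩ := Finset.mem_image.1 hi
    exact h1 v
  · refine Finset.card_image_le.trans ?_
    simp only [Finset.card_univ, Fintype.card_coe]
    exact Finset.card_filter_le _ _
  · intro v hv
    unfold splitVerts
    rw [Finset.biUnion_insert, Finset.mem_union]
    by_cases h : v ∈ H.pVerts i₀ t
    · exact Or.inl h
    · right
      have hv' : v ∈ T' := Finset.mem_filter.2 ⟨hv, h⟩
      exact Finset.mem_biUnion.2 ⟨φ ⟨v, hv'⟩, Finset.mem_image_of_mem _ (Finset.mem_univ _),
        h2 ⟨v, hv'⟩⟩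

lemma event4 (H : LooseHamCycle k G) (hk : 2 ≤ k) (hdvd : (k - 1) ∣ G.verts.card)
    (hn : 0 < G.verts.card) (t j q i₀ : ℕ) (hq : 1 ≤ q) (hjq : j + q = k) (ht0 : 0 < t)
    (ht : t ≤ numE G)
    {p y d x l : ℝ} (h0 : 0 ≤ p) (h1 : p ≤ 1) (hl : 0 ≤ l)
    (hy : 1 ≤ y) (hp : numE G * p ≤ y)
    (hdeg : G.MinDegGe j d)
    (hx : x + l ≤ (d - TOf k t * TOf k t * (G.verts.card : ℝ) ^ (q - 1)) * (t * p) ^ q) :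
    probOver (numE G) p (fun S => ¬ G.MinDegOnGe j (splitVerts H t (insert i₀ S)) x) ≤
      probOver (numE G) p (RelEvent H t i₀) +
      ((j + 1) * y ^ j) * ((((j + 1) * TOf k t : ℕ) : ℝ) ^ j *
        Real.exp (-(l ^ 2 / (2 * (((q : ℝ) * TOf k t) ^ q * ((q : ℝ) * TOf k t) ^ q *
          (2 ^ q * q * y ^ (2 * q - 1))))))) := by
  set W := ((q : ℝ) * TOf k t) ^ q with hW
  have hT0 : (0 : ℝ) < TOf k t := by unfold TOf; positivity
  have hq0 : (0 : ℝ) < q := by exact_mod_cast hq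
  have hy0 : 0 < y := by linarith
  have hW0 : 0 < W := by positivity
  set D := W * W * (2 ^ q * q * y ^ (2 * q - 1)) with hD
  have hD0 : 0 < D := by positivity
  set F := Finset.powersetCard q (Finset.range (numE G)) with hF
  set z := Real.exp (-(l ^ 2 / (2 * D))) with hz
  have hz0 : 0 ≤ z := (Real.exp_pos _).le
  have hw0 : ∀ T A, 0 ≤ wF H t q T A := fun T A => Nat.cast_nonneg _
  have hFU : ∀ A ∈ F, A ⊆ Finset.range (numE G) := fun A hA => (Finset.mem_powersetCard.1 hA).1
  refine (probOver_or h0 h1 _ _ (fun S => ∃ J ∈ (Finset.range (numE G)).powerset.filter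
    (fun J => J.card ≤ j), ∃ T ∈ Finset.powersetCard j (splitVerts H t (insert i₀ J)),
      J ⊆ S ∧ XW F (wF H t q T) S < x) ?_).trans (add_le_add le_rfl ?_)
  · intro S hS h
    by_cases hrel : RelEvent H t i₀ S
    · exact Or.inl hrel
    right
    unfold HGraph.MinDegOnGe at h
    push Not at h
    obtain ⟨T, hT, hTj, hlt⟩ := h
    obtain ⟨J, hJS, hJc, hTJ⟩ := exists_small H t i₀ T S hT
    refine ⟨J, Finset.mem_filter.2 ⟨Finset.mem_powerset.2 (hJS.trans hS), hTj ▸ hJc⟩, T,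
      Finset.mem_powersetCard.2 ⟨hTJ, hTj⟩, hJS, ?_⟩
    exact (XW_le_deg H hk hdvd hn t q i₀ T S hS hT hrel).trans_lt hlt
  refine (probOver_union h0 h1 _ _ _ (fun S _ h => h)).trans ?_
  have hmain : ∀ J ∈ (Finset.range (numE G)).powerset.filter (fun J => J.card ≤ j),
      probOver (numE G) p (fun S => ∃ T ∈ Finset.powersetCard j (splitVerts H t (insert i₀ J)),
        J ⊆ S ∧ XW F (wF H t q T) S < x) ≤
      p ^ J.card * ((((j + 1) * TOf k t : ℕ) : ℝ) ^ j * z) := by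
    intro J hJ
    obtain ⟨hJU, hJc⟩ := Finset.mem_filter.1 hJ
    have hJU := Finset.mem_powerset.1 hJU
    refine (probOver_union h0 h1 _ _ _ (fun S _ h => h)).trans ?_
    refine (Finset.sum_le_card_nsmul _ _ (p ^ J.card * z) ?_).trans ?_
    · intro T hT
      obtain ⟨hTs, hTj⟩ := Finset.mem_powersetCard.1 hT
      have hTv := hTs.trans (splitVerts_sub H hn t _)
      rw [probOver_eq]
      refine le_trans (le_of_eq (EU_congr fun S _ => by congr))
        (janson_joint h0 h1 F hFU (wF H t q T) (hw0 T) x l D hl ?_ hD0 ?_ J hJU)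
      · refine hx.trans (le_trans ?_ (mean_ge H hk hdvd hn t q T ht h0))
        apply mul_le_mul_of_nonneg_right _ (by positivity)
        have h2 := card_linkF H hk hdvd hn t q T (by omega)
        have h3 : (G.degOn T : ℝ) ≤ ((linkF H t q T).card : ℝ) +
            TOf k t * TOf k t * (G.verts.card : ℝ) ^ (q - 1) := by exact_mod_cast h2
        have h4 := hdeg T hTv hTj
        linarith
      · have hs := sum_pairs (Finset.range (numE G)) h0 hy (by simpa using hp) q hq
        calc _ ≤ ∑ A ∈ F, W * ∑ B ∈ F.filter (fun B => ¬ Disjoint A B), W * p ^ (A ∪ B).card := by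
              apply Finset.sum_le_sum
              intro A hA
              apply mul_le_mul (wF_le H t q T A (Finset.mem_powersetCard.1 hA).2) _ _ hW0.le
              · apply Finset.sum_le_sum
                intro B hB
                apply mul_le_mul_of_nonneg_right _ (by positivity)
                exact wF_le H t q T B (Finset.mem_powersetCard.1 (Finset.mem_filter.1 hB).1).2
              · exact Finset.sum_nonneg fun B _ => mul_nonneg (hw0 T B) (by positivity)
          _ = W * W * ∑ A ∈ F, ∑ B ∈ F.filter (fun B => ¬ Disjoint A B), p ^ (A ∪ B).card := by
              rw [Finset.mul_sum]
              apply Finset.sum_congr rfl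
              intro A _
              rw [← Finset.mul_sum]; ring
          _ ≤ D := mul_le_mul_of_nonneg_left hs (by positivity)
    · rw [nsmul_eq_mul, Finset.card_powersetCard]
      have h2 : (splitVerts H t (insert i₀ J)).card.choose j ≤ ((j + 1) * TOf k t) ^ j := by
        refine (Nat.choose_le_pow _ _).trans (Nat.pow_le_pow_left ?_ j)
        refine (card_splitVerts_le H t _).trans (Nat.mul_le_mul_right _ ?_)
        have := Finset.card_insert_le i₀ J
        omega
      have h3 : (((splitVerts H t (insert i₀ J)).card.choose j : ℕ) : ℝ) ≤
          (((j + 1) * TOf k t : ℕ) : ℝ) ^ j := by exact_mod_cast h2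
      calc _ ≤ (((j + 1) * TOf k t : ℕ) : ℝ) ^ j * (p ^ J.card * z) :=
            mul_le_mul_of_nonneg_right h3 (by positivity)
        _ = _ := by ring
  refine (Finset.sum_le_sum hmain).trans ?_
  rw [← Finset.sum_mul]
  apply mul_le_mul_of_nonneg_right _ (by positivity)
  exact sum_small (Finset.range (numE G)) h0 hy (by simpa using hp) j

end Events


lemma exists_t (j k q : ℕ) (hk : 2 ≤ k) (hq : 1 ≤ q) (ε δ : ℝ) (hε : 0 < ε) (hδ : 0 ≤ δ) :
    ∃ t : ℕ, 2 ≤ t ∧ t ≤ TOf k t ∧ TOf k t ≤ mOf k t ∧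
      ((TOf k t + k * (TOf k t * TOf k t) : ℕ) : ℝ) < ε * (mOf k t : ℝ) / 4 ∧
      (δ + 7 * ε / 8) * ((TOf k t : ℝ) * mOf k t) ^ q ≤
        (δ + 15 * ε / 16) * (((TOf k t : ℝ) - 1) * ((mOf k t : ℝ) - 1)) ^ q ∧
      2 * ((j : ℝ) + 1) ^ (j + 1) * (mOf k t : ℝ) ^ (2 * j + 1) ≤
        Real.exp (ε ^ 2 / (128 * ((q : ℝ) ^ (2 * q) * 2 ^ q * q)) * mOf k t) := by
  have hTt : ∀ t, t ≤ TOf k t := fun t => by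
    unfold TOf
    have : t * 1 ≤ t * (k - 1) := Nat.mul_le_mul_left _ (by omega)
    omega
  have hmT : ∀ t, 2 ≤ t → TOf k t * t ^ 2 ≤ mOf k t := fun t ht => by
    unfold mOf mtOf
    exact Nat.mul_le_mul_left _ (Nat.pow_le_pow_right (by omega) (by omega))
  have hmT' : ∀ t, 2 ≤ t → TOf k t ≤ mOf k t := fun t ht =>
    le_trans (Nat.le_mul_of_pos_right _ (by positivity)) (hmT t ht)
  have hq0 : (0 : ℝ) < q := by exact_mod_cast hq
  set c := ε ^ 2 / (128 * ((q : ℝ) ^ (2 * q) * 2 ^ q * q)) with hc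
  have hc0 : 0 < c := by positivity
  have ta : Filter.Tendsto (fun t : ℕ => (mOf k t : ℝ)) Filter.atTop Filter.atTop := by
    apply Filter.tendsto_atTop_mono' _ _ (tendsto_natCast_atTop_atTop (R := ℝ))
    filter_upwards [Filter.eventually_ge_atTop 2] with t ht
    exact_mod_cast (hTt t).trans (hmT' t ht)
  have ea : ∀ᶠ t : ℕ in Filter.atTop, 2 * ((j : ℝ) + 1) ^ (j + 1) * (mOf k t : ℝ) ^ (2 * j + 1) ≤
        Real.exp (c * mOf k t) := by
    apply ta.eventually (p := fun x : ℝ => 2 * ((j : ℝ) + 1) ^ (j + 1) * x ^ (2 * j + 1) ≤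
        Real.exp (c * x))
    set A := 2 * ((j : ℝ) + 1) ^ (j + 1) with hA
    have hA0 : 0 < A := by positivity
    have h := (isLittleO_pow_exp_pos_mul_atTop (2 * j + 1) hc0).bound (inv_pos.2 hA0)
    filter_upwards [h, Filter.eventually_ge_atTop 0] with x hx hx0
    rw [Real.norm_of_nonneg (by positivity), Real.norm_of_nonneg (by positivity)] at hx
    calc A * x ^ (2 * j + 1) ≤ A * (A⁻¹ * Real.exp (c * x)) :=
          mul_le_mul_of_nonneg_left hx hA0.le
      _ = _ := by field_simp
  have eb : ∀ᶠ t : ℕ in Filter.atTop, 8 * (k : ℝ) ^ 2 / ε < t :=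
    (tendsto_natCast_atTop_atTop (R := ℝ)).eventually_gt_atTop _
  have ec : ∀ᶠ t : ℕ in Filter.atTop, δ + 7 * ε / 8 <
      (δ + 15 * ε / 16) * ((1 - (t : ℝ)⁻¹) * (1 - (t : ℝ)⁻¹)) ^ q := by
    have h1 : Filter.Tendsto (fun t : ℕ => 1 - (t : ℝ)⁻¹) Filter.atTop (nhds (1 - 0)) :=
      tendsto_const_nhds.sub (tendsto_inv_atTop_zero.comp (tendsto_natCast_atTop_atTop (R := ℝ)))
    have h2 := ((h1.mul h1).pow q).const_mul (δ + 15 * ε / 16)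
    apply h2.eventually_const_lt
    simp; linarith
  obtain ⟨t, ⟨⟨ha, hb⟩, hcc⟩, ht2⟩ := (((ea.and eb).and ec).and
    (Filter.eventually_ge_atTop 2)).exists
  refine ⟨t, ht2, hTt t, hmT' t ht2, ?_, ?_, ha⟩
  · have h1 : ((TOf k t : ℝ)) ≤ k * t := by
      have : TOf k t ≤ k * t := by
        unfold TOf
        obtain ⟨k', rfl⟩ : ∃ k', k = k' + 1 := ⟨k - 1, by omega⟩
        simp only [Nat.add_sub_cancel]
        nlinarith
      exact_mod_cast this
    have h2 : (TOf k t : ℝ) * t ^ 2 ≤ mOf k t := by exact_mod_cast hmT t ht2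
    have hT0 : (0 : ℝ) < TOf k t := by unfold TOf; positivity
    have ht0 : (2 : ℝ) ≤ t := by exact_mod_cast ht2
    have hk0 : (2 : ℝ) ≤ k := by exact_mod_cast hk
    rw [div_lt_iff₀ hε] at hb
    push_cast
    have h3 : 1 + (k : ℝ) * TOf k t ≤ 2 * k ^ 2 * t := by
      have : (k : ℝ) * TOf k t ≤ k * (k * t) := mul_le_mul_of_nonneg_left h1 (by positivity)
      have : (1 : ℝ) ≤ k ^ 2 * t := by nlinarith
      nlinarith
    have h4 : 2 * (k : ℝ) ^ 2 * t < ε * t ^ 2 / 4 := by nlinarith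
    calc (TOf k t : ℝ) + k * (TOf k t * TOf k t) = TOf k t * (1 + k * TOf k t) := by ring
      _ < TOf k t * (ε * t ^ 2 / 4) := mul_lt_mul_of_pos_left (by linarith) hT0
      _ = ε * (TOf k t * t ^ 2) / 4 := by ring
      _ ≤ _ := by gcongr
  · have ht0 : (0 : ℝ) < t := by exact_mod_cast (by omega : 0 < t)
    have ht1 : (1 : ℝ) ≤ t := by exact_mod_cast (by omega : 1 ≤ t)
    have hi : (t : ℝ)⁻¹ ≤ 1 := inv_le_one_of_one_le₀ ht1
    have key : ∀ x : ℝ, (t : ℝ) ≤ x → (1 - (t : ℝ)⁻¹) * x ≤ x - 1 := by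
      intro x hx
      have : 1 ≤ (t : ℝ)⁻¹ * x := by
        rw [inv_mul_eq_div, le_div_iff₀ ht0]; linarith
      linarith
    have k1 := key (TOf k t) (by exact_mod_cast hTt t)
    have k2 := key (mOf k t) (by exact_mod_cast (hTt t).trans (hmT' t ht2))
    have hs : 0 ≤ 1 - (t : ℝ)⁻¹ := by linarith
    calc (δ + 7 * ε / 8) * ((TOf k t : ℝ) * mOf k t) ^ q
        ≤ (δ + 15 * ε / 16) * ((1 - (t : ℝ)⁻¹) * (1 - (t : ℝ)⁻¹)) ^ q *
          ((TOf k t : ℝ) * mOf k t) ^ q := mul_le_mul_of_nonneg_right hcc.le (by positivity)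
      _ = (δ + 15 * ε / 16) * (((1 - (t : ℝ)⁻¹) * TOf k t) * ((1 - (t : ℝ)⁻¹) * mOf k t)) ^ q := by
          rw [mul_assoc, ← mul_pow]; congr 2; ring
      _ ≤ _ := by
          apply mul_le_mul_of_nonneg_left _ (by positivity)
          apply pow_le_pow_left₀ (by positivity)
          apply mul_le_mul k1 k2 (by positivity)
          exact le_trans (by positivity) k1

lemma exp_part (j q : ℕ) (hq : 1 ≤ q) (ε T m : ℝ) (hT : 1 ≤ T) (hTm : T ≤ m)
    (ha : 2 * ((j : ℝ) + 1) ^ (j + 1) * m ^ (2 * j + 1) ≤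
        Real.exp (ε ^ 2 / (128 * ((q : ℝ) ^ (2 * q) * 2 ^ q * q)) * m)) :
    (((j : ℝ) + 1) * m ^ j) * ((((j : ℝ) + 1) * T) ^ j *
        Real.exp (-((ε / 8 * (T * m) ^ q) ^ 2 / (2 * (((q : ℝ) * T) ^ q * ((q : ℝ) * T) ^ q *
          (2 ^ q * q * m ^ (2 * q - 1))))))) ≤ 1 / (2 * m) := by
  have hq0 : (0 : ℝ) < q := by exact_mod_cast hq
  have hm0 : 0 < m := by linarith
  have hT0 : 0 < T := by linarith
  have e : (ε / 8 * (T * m) ^ q) ^ 2 / (2 * (((q : ℝ) * T) ^ q * ((q : ℝ) * T) ^ q *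
          (2 ^ q * q * m ^ (2 * q - 1)))) = ε ^ 2 / (128 * ((q : ℝ) ^ (2 * q) * 2 ^ q * q)) * m := by
    have h1 : (m ^ q) ^ 2 = m ^ (2 * q - 1) * m := by
      rw [← pow_mul, ← pow_succ]; congr 1; omega
    have h2 : (q : ℝ) ^ (2 * q) = ((q : ℝ) ^ q) ^ 2 := by rw [← pow_mul]; congr 1; omega
    rw [h2, mul_pow, mul_pow, mul_pow, mul_pow, h1]
    have := pow_pos hT0 q
    have := pow_pos hq0 q
    have := pow_pos hm0 (2 * q - 1)
    have := pow_pos (two_pos : (0 : ℝ) < 2) q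
    generalize T ^ q = a at *
    generalize (q : ℝ) ^ q = b at *
    generalize m ^ (2 * q - 1) = d at *
    generalize (2 : ℝ) ^ q = f at *
    field_simp
    ring
  rw [e, Real.exp_neg]
  set X := Real.exp (ε ^ 2 / (128 * ((q : ℝ) ^ (2 * q) * 2 ^ q * q)) * m) with hX
  have hX0 : 0 < X := Real.exp_pos _
  have h1 : (((j : ℝ) + 1) * m ^ j) * ((((j : ℝ) + 1) * T) ^ j) * (2 * m) ≤ X := by
    refine le_trans ?_ ha
    calc (((j : ℝ) + 1) * m ^ j) * ((((j : ℝ) + 1) * T) ^ j) * (2 * m)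
        ≤ (((j : ℝ) + 1) * m ^ j) * ((((j : ℝ) + 1) * m) ^ j) * (2 * m) := by gcongr
      _ = _ := by rw [mul_pow]; ring
  rw [le_div_iff₀ (by positivity)]
  calc _ = (((j : ℝ) + 1) * m ^ j) * ((((j : ℝ) + 1) * T) ^ j) * (2 * m) * X⁻¹ := by ring
    _ ≤ X * X⁻¹ := by gcongr
    _ = 1 := mul_inv_cancel₀ hX0.ne'

lemma mu_part (n K m : ℝ) (hn : 0 < n) (hm : 1 ≤ m) (hK : 1 ≤ K) (k : ℕ) (hk : 2 ≤ k) (P : ℝ)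
    (hP0 : 0 ≤ P) (hP : P ≤ K / n) :
    (n * (1 / (m * K ^ (2 * k)) * n ^ (k - 1))) * P ^ k ≤ 1 / m ∧
    (n ^ k * (1 / (m * K ^ (2 * k)) * n ^ (k - 1))) * P ^ (2 * k - 1) ≤ 1 / m := by
  have hm0 : 0 < m := by linarith
  have hK0 : 0 < K := by linarith
  have key : ∀ r : ℕ, r ≤ 2 * k → (n ^ r * (1 / (m * K ^ (2 * k)))) * P ^ r ≤ 1 / m := by
    intro r hr
    calc (n ^ r * (1 / (m * K ^ (2 * k)))) * P ^ r
        ≤ (n ^ r * (1 / (m * K ^ (2 * k)))) * (K / n) ^ r := by gcongr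
      _ = K ^ r / (m * K ^ (2 * k)) := by rw [div_pow]; field_simp
      _ ≤ K ^ (2 * k) / (m * K ^ (2 * k)) := by gcongr
      _ = 1 / m := by field_simp
  constructor
  · convert key k (by omega) using 2
    rw [show n ^ k = n * n ^ (k - 1) by rw [← pow_succ']; congr 1; omega]; ring
  · convert key (2 * k - 1) (by omega) using 2
    rw [show n ^ (2 * k - 1) = n ^ k * n ^ (k - 1) by rw [← pow_add]; congr 1; omega]; ring

/-- Claim: each of the five bad events for the random splitting has
probability at most `1/m`. -/
theorem bad_events_unlikely (j k : ℕ) (hj : 1 ≤ j) (hjk : j < k)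
    (ε : ℝ) (hε : 0 < ε) :
    ∃ (t : ℕ) (γ μ : ℝ) (n₀ : ℕ), 0 < t ∧ 0 < γ ∧ 0 < μ ∧
      ∀ n : ℕ, n₀ ≤ n → (k - 1) ∣ n →
        ∀ G : HGraph k, G.verts.card = n →
          G.MinDegGe j ((looseHamThreshold j k + ε) * (n : ℝ) ^ (k - j)) →
          ∀ χ : Finset ℕ → ℕ, GloballyBounded G χ (μ * (n : ℝ) ^ (k - 1)) →
            ∀ H : LooseHamCycle k G, ∀ i₀ < numE G,
              (probOver (numE G) ((((mOf k t - 1) * (k - 1) : ℕ) : ℝ) / (n : ℝ))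
                  (fun S => ∃ A ⊆ splitVerts H t S, A.card = k - 1 ∧ SpreadSet H t A ∧
                    ε * (mOf k t : ℝ) / 4 ≤
                      (((G.inducedEdges (splitVerts H t (insert i₀ S))).filter
                          fun e => A ⊆ e ∧ ∃ f ∈ H.cedges, χ f = χ e).card : ℝ)) ≤
                (1 : ℝ) / (mOf k t : ℝ)) ∧
              (probOver (numE G) ((((mOf k t - 1) * (k - 1) : ℕ) : ℝ) / (n : ℝ))
                  (fun S => ∃ e ∈ G.edges, ∃ f ∈ G.edges, e ≠ f ∧ χ e = χ f ∧
                    (e ∩ f).card ≤ 1 ∧ SpreadSet H t (e ∪ f) ∧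
                    e ∪ f ⊆ splitVerts H t S) ≤
                (1 : ℝ) / (mOf k t : ℝ)) ∧
              (probOver (numE G) ((((mOf k t - 1) * (k - 1) : ℕ) : ℝ) / (n : ℝ))
                  (fun S => ∃ e ∈ G.edges, ∃ f ∈ G.edges, χ e = χ f ∧ Disjoint e f ∧
                    AlmostSpreadSet H t (e ∪ f) ∧ e ∪ f ⊆ splitVerts H t S) ≤
                (1 : ℝ) / (mOf k t : ℝ)) ∧
              (probOver (numE G) ((((mOf k t - 1) * (k - 1) : ℕ) : ℝ) / (n : ℝ))
                  (fun S => ¬ G.MinDegOnGe j (splitVerts H t (insert i₀ S))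
                    ((looseHamThreshold j k + 3 * ε / 4) * (MOf k t : ℝ) ^ (k - j))) ≤
                (1 : ℝ) / (mOf k t : ℝ)) ∧
              (probOver (numE G) ((((mOf k t - 1) * (k - 1) : ℕ) : ℝ) / (n : ℝ))
                  (fun S => ∃ i ∈ insert i₀ S, ∃ i' ∈ insert i₀ S, i ≠ i' ∧
                    ∃ u ∈ H.pVerts i t, ∃ v ∈ H.pVerts i' t, u ≠ v ∧ Close H t u v) ≤
                (1 : ℝ) / (mOf k t : ℝ)) := by
  have hk : 2 ≤ k := by omega
  have hδ : 0 ≤ looseHamThreshold j k := by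
    unfold looseHamThreshold
    exact Real.sInf_nonneg fun x hx => hx.1
  obtain ⟨t, ht2, htT, hTm, hb, hc, ha⟩ :=
    exists_t j k (k - j) hk (by omega) ε (looseHamThreshold j k) hε hδ
  set δ := looseHamThreshold j k with hδd
  have hT1 : (1 : ℝ) ≤ TOf k t := by exact_mod_cast (by omega : 1 ≤ TOf k t)
  have hTm' : (TOf k t : ℝ) ≤ mOf k t := by exact_mod_cast hTm
  have hm1 : (1 : ℝ) ≤ mOf k t := hT1.trans hTm'
  have hm1' : 1 ≤ mOf k t := by omega
  have hk1 : (1 : ℝ) ≤ k := by exact_mod_cast (by omega : 1 ≤ k)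
  have ht0 : (0 : ℝ) < t := by exact_mod_cast (by omega : 0 < t)
  set K : ℝ := TOf k t * mOf k t * k with hK
  have hK1 : 1 ≤ K := by
    have : (1 : ℝ) ≤ TOf k t * mOf k t := by nlinarith
    nlinarith
  set R : ℝ := 2 * DOf k t * (mOf k t : ℝ) ^ 3 * k with hR
  have hR0 : 0 ≤ R := by positivity
  set Q : ℝ := 16 * ((TOf k t : ℝ) * TOf k t) / ε with hQ
  have hQ0 : 0 ≤ Q := by positivity
  refine ⟨t, 1, 1 / (mOf k t * K ^ (2 * k)), ⌈K + t * k + Q + R⌉₊, by omega, one_pos,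
    by positivity, ?_⟩
  intro n hn0 hdvd G hG hdeg χ hχ H i₀ hi₀
  subst hG
  have hnR : K + t * k + Q + R ≤ (G.verts.card : ℝ) := Nat.ceil_le.1 hn0
  have htk : (0 : ℝ) ≤ t * k := by positivity
  have hnK : K ≤ (G.verts.card : ℝ) := by linarith
  have hnt : (t : ℝ) * k ≤ (G.verts.card : ℝ) := by linarith
  have hnQ : Q ≤ (G.verts.card : ℝ) := by linarith
  have hnR' : R ≤ (G.verts.card : ℝ) := by linarith
  have hnpos : (0 : ℝ) < G.verts.card := by linarith
  have hn : 0 < G.verts.card := by exact_mod_cast hnpos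
  have hcard := card_eq_numE hdvd
  have hcardR : (G.verts.card : ℝ) = numE G * ((k - 1 : ℕ) : ℝ) := by exact_mod_cast hcard
  have hk1pos : (0 : ℝ) < ((k - 1 : ℕ) : ℝ) := by exact_mod_cast (by omega : 0 < k - 1)
  have hkk : ((k - 1 : ℕ) : ℝ) ≤ k := by exact_mod_cast Nat.sub_le k 1
  have hmsub : ((mOf k t - 1 : ℕ) : ℝ) = (mOf k t : ℝ) - 1 := by
    rw [Nat.cast_sub hm1']; simp
  set p : ℝ := (((mOf k t - 1) * (k - 1) : ℕ) : ℝ) / (G.verts.card : ℝ) with hp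
  have hpn : p * G.verts.card = ((mOf k t : ℝ) - 1) * ((k - 1 : ℕ) : ℝ) := by
    rw [hp, div_mul_cancel₀ _ hnpos.ne']; push_cast [hmsub]; rfl
  have h0 : 0 ≤ p := by positivity
  have hpK : p ≤ mOf k t * k / G.verts.card := by
    rw [le_div_iff₀ hnpos, hpn]
    apply mul_le_mul _ hkk hk1pos.le (by positivity)
    linarith
  have hTp : TOf k t * p ≤ K / G.verts.card := by
    calc TOf k t * p ≤ TOf k t * (mOf k t * k / G.verts.card) := by gcongr
      _ = _ := by rw [hK]; ring
  have h1 : p ≤ 1 := by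
    have h2 : K / G.verts.card ≤ 1 := (div_le_one hnpos).2 hnK
    nlinarith
  have hNp : numE G * p = (mOf k t : ℝ) - 1 := by
    have h2 : (numE G * p) * ((k - 1 : ℕ) : ℝ) = ((mOf k t : ℝ) - 1) * ((k - 1 : ℕ) : ℝ) := by
      rw [← hpn, hcardR]; ring
    exact mul_right_cancel₀ hk1pos.ne' h2
  have htN : t ≤ numE G := by
    have h2 : t * k ≤ numE G * (k - 1) := by rw [← hcard]; exact_mod_cast hnt
    have h3 : numE G * (k - 1) ≤ numE G * k := Nat.mul_le_mul_left _ (Nat.sub_le _ _)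
    exact Nat.le_of_mul_le_mul_right (h2.trans h3) (by omega)
  have hb0 : 0 ≤ 1 / (mOf k t * K ^ (2 * k)) * (G.verts.card : ℝ) ^ (k - 1) := by positivity
  obtain ⟨mu1, mu2⟩ := mu_part G.verts.card K (mOf k t) hnpos hm1 hK1 k hk (TOf k t * p)
    (by positivity) hTp
  have hrel : probOver (numE G) p (RelEvent H t i₀) ≤ 1 / (2 * mOf k t) := by
    refine (prob_rel_le H hk hdvd hn t i₀ h0 h1).trans ?_
    calc (numE G : ℝ) * (DOf k t * p ^ 2) + DOf k t * p
        = DOf k t * p * (numE G * p + 1) := by ring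
      _ = DOf k t * p * mOf k t := by rw [hNp]; ring
      _ ≤ DOf k t * (mOf k t * k / G.verts.card) * mOf k t := by gcongr
      _ ≤ 1 / (2 * mOf k t) := by
        rw [le_div_iff₀ (by positivity)]
        calc DOf k t * (mOf k t * k / G.verts.card) * mOf k t * (2 * mOf k t)
            = R / G.verts.card := by rw [hR]; ring
          _ ≤ 1 := (div_le_one hnpos).2 hnR'
  have hhalf : 1 / (2 * (mOf k t : ℝ)) + 1 / (2 * (mOf k t : ℝ)) = 1 / mOf k t := by
    field_simp; norm_num
  have hhp : 0 ≤ 1 / (2 * (mOf k t : ℝ)) := by positivity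
  refine ⟨?_, ?_, ?_, ?_, ?_⟩
  · exact (event1 H hk hdvd hn χ t i₀ h0 h1 hb0 hχ hb).trans mu1
  · exact (event23 H hk hdvd hn χ t h0 h1 hχ _
      (fun S _ h => event2_hyp H hk hdvd hn χ t S h)).trans mu2
  · exact (event23 H hk hdvd hn χ t h0 h1 hχ _
      (fun S _ h => event3_hyp H hk hdvd hn χ t S h)).trans mu2
  · set q := k - j with hq
    have hM : (MOf k t : ℝ) = TOf k t * mOf k t := by unfold MOf; push_cast; ring
    have hTsub : (TOf k t : ℝ) - 1 = t * ((k - 1 : ℕ) : ℝ) := by unfold TOf; push_cast; ring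
    have hx : (δ + 3 * ε / 4) * (MOf k t : ℝ) ^ q + ε / 8 * ((TOf k t : ℝ) * mOf k t) ^ q ≤
        ((δ + ε) * (G.verts.card : ℝ) ^ q -
          TOf k t * TOf k t * (G.verts.card : ℝ) ^ (q - 1)) * (t * p) ^ q := by
      rw [hM]
      calc _ = (δ + 7 * ε / 8) * ((TOf k t : ℝ) * mOf k t) ^ q := by ring
        _ ≤ _ := hc
        _ = (δ + 15 * ε / 16) * (G.verts.card : ℝ) ^ q * (t * p) ^ q := by
          rw [hTsub, mul_assoc _ (_ ^ q) (_ ^ q), ← mul_pow]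
          congr 2
          calc (t : ℝ) * ((k - 1 : ℕ) : ℝ) * ((mOf k t : ℝ) - 1)
              = t * (((mOf k t : ℝ) - 1) * ((k - 1 : ℕ) : ℝ)) := by ring
            _ = _ := by rw [← hpn]; ring
        _ ≤ _ := by
          apply mul_le_mul_of_nonneg_right _ (by positivity)
          have e : (G.verts.card : ℝ) ^ q = G.verts.card * (G.verts.card : ℝ) ^ (q - 1) := by
            rw [← pow_succ']; congr 1; omega
          have h3 : (TOf k t : ℝ) * TOf k t ≤ ε / 16 * G.verts.card := by
            rw [hQ, div_le_iff₀ hε] at hnQ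
            linarith
          have h4 := mul_le_mul_of_nonneg_right h3
            (pow_nonneg hnpos.le (q - 1))
          rw [mul_assoc (ε / 16), ← e] at h4
          linarith
    have h4 := event4 H hk hdvd hn t j q i₀ (by omega) (by omega) (by omega) htN h0 h1
      (l := ε / 8 * ((TOf k t : ℝ) * mOf k t) ^ q) (by positivity) hm1 (by linarith) hdeg hx
    have h5 := exp_part j q (by omega) ε (TOf k t) (mOf k t) hT1 hTm' ha
    push_cast at h4
    linarith
  · refine (probOver_mono h0 h1 _ (RelEvent H t i₀) ?_).trans (by linarith)
    rintro S _ ⟨i, hi, i', hi', hne, u, hu, v, hv, _, hcl⟩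
    exact ⟨i, hi, i', hi', hne, u, hu, v, hv, hcl⟩

end
end

section
/- In the Setup: let H be a loose Hamilton cycle in G and P_0 ⊆ H a loose path of length t. If 𝒫 is a t-balanced m-splitting of H that is suitable for P_0 and satisfies δ_j(G[V(𝒫)]) ≥ (δ_j^k(1)+3ε/4)·M^{k-j}, then V(𝒫) admits a viable partition. -/
open Finset

open scoped Classical

noncomputable section

theorem exp_conv (c x : ℝ) (hc : 0 < c) (hx : |x| ≤ c) :
    Real.exp x ≤ Real.cosh c + x / c * Real.sinh c := by
  have h := abs_le.1 hx
  have h1 : 0 ≤ (1 + x / c) / 2 := by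
    have : -1 ≤ x / c := by rw [le_div_iff₀ hc]; linarith
    linarith
  have h2 : 0 ≤ (1 - x / c) / 2 := by
    have : x / c ≤ 1 := by rw [div_le_iff₀ hc]; linarith
    linarith
  have := convexOn_exp.2 (Set.mem_univ c) (Set.mem_univ (-c)) h1 h2 (by ring)
  simp only [smul_eq_mul] at this
  have e : (1 + x / c) / 2 * c + (1 - x / c) / 2 * -c = x := by field_simp; ring
  rw [e] at this
  rw [Real.cosh_eq, Real.sinh_eq]
  linarith

/-- Hoeffding for one coordinate -/
theorem hoeff1 {A : Type} [Fintype A] [Nonempty A] (g : A → ℝ) (c : ℝ) (hc : 0 ≤ c)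
    (hg : ∀ a b, g a - g b ≤ c) :
    ∑ a, Real.exp (g a) ≤
      Fintype.card A * Real.exp ((∑ a, g a) / Fintype.card A + c ^ 2 / 2) := by
  have hN : (0 : ℝ) < Fintype.card A := by exact_mod_cast Fintype.card_pos
  rcases hc.eq_or_lt with rfl | hc
  · have hcon : ∀ a b, g a = g b := fun a b => by linarith [hg a b, hg b a]
    obtain ⟨a0⟩ := ‹Nonempty A›
    simp only [fun a => hcon a a0, Finset.sum_const, Finset.card_univ, nsmul_eq_mul]
    rw [mul_div_cancel_left₀ _ hN.ne']
    simp
  set μ := (∑ a, g a) / Fintype.card A with hμ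
  have hs : ∑ a, (g a - μ) = 0 := by
    rw [Finset.sum_sub_distrib]; simp [hμ]; field_simp; simp
  have hb : ∀ a, |g a - μ| ≤ c := by
    intro a
    have e1 : Fintype.card A * (g a - μ) = ∑ b, (g a - g b) := by
      rw [Finset.sum_sub_distrib]; simp [hμ]; field_simp
    have e2 : ∑ b, (g a - g b) ≤ Fintype.card A * c := by
      calc _ ≤ ∑ b : A, c := Finset.sum_le_sum fun b _ => hg a b
        _ = _ := by simp
    have e3 : -(Fintype.card A * c) ≤ ∑ b, (g a - g b) := by
      calc _ = ∑ b : A, -c := by simp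
        _ ≤ _ := Finset.sum_le_sum fun b _ => by linarith [hg b a]
    rw [abs_le]
    constructor
    · by_contra hh; push Not at hh; nlinarith
    · by_contra hh; push Not at hh; nlinarith
  have : ∑ a, Real.exp (g a - μ) ≤ Fintype.card A * Real.exp (c ^ 2 / 2) := by
    calc _ ≤ ∑ a, (Real.cosh c + (g a - μ) / c * Real.sinh c) :=
          Finset.sum_le_sum fun a _ => exp_conv c _ hc (hb a)
      _ = Fintype.card A * Real.cosh c := by
          rw [Finset.sum_add_distrib, ← Finset.sum_mul, ← Finset.sum_div, hs]; simp
      _ ≤ _ := by gcongr; exact Real.cosh_le_exp_half_sq c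
  calc _ = Real.exp μ * ∑ a, Real.exp (g a - μ) := by
        rw [Finset.mul_sum]; refine Finset.sum_congr rfl fun a _ => ?_
        rw [← Real.exp_add]; ring_nf
    _ ≤ Real.exp μ * (Fintype.card A * Real.exp (c ^ 2 / 2)) := by gcongr
    _ = _ := by rw [Real.exp_add]; ring

theorem mcd {A : Type} [Fintype A] [Nonempty A] (c : ℝ) (hc : 0 ≤ c) :
    ∀ (n : ℕ) (f : (Fin n → A) → ℝ)
    (_ : ∀ i ω ω', (∀ l, l ≠ i → ω l = ω' l) → f ω - f ω' ≤ c),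
    ∑ ω, Real.exp (f ω) ≤
      (Fintype.card A : ℝ) ^ n *
        Real.exp ((∑ ω, f ω) / (Fintype.card A : ℝ) ^ n + n * (c ^ 2 / 2))
  | 0, f, _ => by simp
  | n + 1, f, hf => by
    have hN : (0 : ℝ) < Fintype.card A := by exact_mod_cast Fintype.card_pos
    have key : ∀ F : (Fin (n+1) → A) → ℝ, ∑ ω, F ω = ∑ a, ∑ τ : Fin n → A, F (Fin.cons a τ) := by
      intro F
      rw [← Fintype.sum_prod_type' (f := fun a (τ : Fin n → A) => F (Fin.cons a τ))]
      exact (Equiv.sum_comp (Fin.consEquiv fun _ => A) F).symm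
    set g : A → ℝ := fun a => (∑ τ : Fin n → A, f (Fin.cons a τ)) / (Fintype.card A : ℝ) ^ n with hg
    have hgd : ∀ a b, g a - g b ≤ c := by
      intro a b
      rw [hg]; simp only
      rw [← sub_div, div_le_iff₀ (by positivity), ← Finset.sum_sub_distrib]
      calc _ ≤ ∑ τ : Fin n → A, c := Finset.sum_le_sum fun τ _ => by
            apply hf 0
            intro l hl
            obtain ⟨l', rfl⟩ := Fin.exists_succ_eq.2 hl
            simp
        _ = _ := by simp; ring
    have ih : ∀ a, ∑ τ : Fin n → A, Real.exp (f (Fin.cons a τ)) ≤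
        (Fintype.card A : ℝ) ^ n * Real.exp (g a + n * (c ^ 2 / 2)) := by
      intro a
      apply mcd c hc n (fun τ => f (Fin.cons a τ))
      intro i ω ω' h
      apply hf i.succ
      intro l hl
      refine Fin.cases (by simp) (fun l' hl => ?_) l hl
      simp only [Fin.cons_succ]
      exact h l' (fun h => hl (by rw [h]))
    rw [key]
    have hgs : (∑ ω, f ω) / (Fintype.card A : ℝ) ^ (n + 1) = (∑ a, g a) / Fintype.card A := by
      rw [key, hg, ← Finset.sum_div, div_div, pow_succ]
    rw [hgs]
    calc _ ≤ ∑ a, (Fintype.card A : ℝ) ^ n * Real.exp (g a + n * (c ^ 2 / 2)) :=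
          Finset.sum_le_sum fun a _ => ih a
      _ = (Fintype.card A : ℝ) ^ n * Real.exp (n * (c ^ 2 / 2)) * ∑ a, Real.exp (g a) := by
          rw [Finset.mul_sum]; refine Finset.sum_congr rfl fun a _ => ?_
          rw [Real.exp_add]; ring
      _ ≤ (Fintype.card A : ℝ) ^ n * Real.exp (n * (c ^ 2 / 2)) *
          (Fintype.card A * Real.exp ((∑ a, g a) / Fintype.card A + c ^ 2 / 2)) := by
          gcongr; exact hoeff1 g c hc hgd
      _ = _ := by
          push_cast
          rw [pow_succ, Real.exp_add, Real.exp_add, add_mul, Real.exp_add]; ring_nf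

theorem mcd_tail {A : Type} [Fintype A] [Nonempty A] (c : ℝ) (hc : 0 < c) (n : ℕ) (hn : 0 < n)
    (f : (Fin n → A) → ℝ)
    (hf : ∀ i ω ω', (∀ l, l ≠ i → ω l = ω' l) → f ω - f ω' ≤ c) (τ x : ℝ) (hτ : 0 ≤ τ)
    (hx : x + τ ≤ (∑ ω, f ω) / (Fintype.card A : ℝ) ^ n) :
    ((univ.filter fun ω => f ω < x).card : ℝ) ≤
      (Fintype.card A : ℝ) ^ n * Real.exp (-(τ ^ 2 / (2 * n * c ^ 2))) := by
  have hn' : (0 : ℝ) < n := by exact_mod_cast hn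
  set s : ℝ := τ / (n * c ^ 2) with hs
  have hs0 : 0 ≤ s := by positivity
  set μ := (∑ ω, f ω) / (Fintype.card A : ℝ) ^ n
  have h := mcd (s * c) (by positivity) n (fun ω => -s * f ω) (by
    intro i ω ω' h
    have := hf i ω' ω (fun l hl => (h l hl).symm)
    nlinarith)
  rw [← Finset.mul_sum, mul_div_assoc] at h
  have h2 : ((univ.filter fun ω => f ω < x).card : ℝ) * Real.exp (-s * x) ≤
      ∑ ω, Real.exp (-s * f ω) := by
    calc _ = ∑ ω ∈ univ.filter (fun ω => f ω < x), Real.exp (-s * x) := by simp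
      _ ≤ ∑ ω ∈ univ.filter (fun ω => f ω < x), Real.exp (-s * f ω) := by
          refine Finset.sum_le_sum fun ω hω => ?_
          apply Real.exp_le_exp.2
          have := (Finset.mem_filter.1 hω).2
          nlinarith
      _ ≤ _ := Finset.sum_le_sum_of_subset_of_nonneg (Finset.filter_subset _ _)
          fun _ _ _ => (Real.exp_pos _).le
  have h3 := h2.trans h
  rw [← le_div_iff₀ (Real.exp_pos _), mul_div_assoc, ← Real.exp_sub] at h3
  refine h3.trans ?_
  gcongr
  have e : -s * μ + n * ((s * c) ^ 2 / 2) - -s * x = - s * (μ - x) + n * ((s * c) ^ 2 / 2) := by ring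
  rw [e]
  have e2 : - s * (μ - x) ≤ - s * τ := by nlinarith
  have e3 : - s * τ + n * ((s * c) ^ 2 / 2) = -(τ ^ 2 / (2 * n * c ^ 2)) := by
    rw [hs]; field_simp; ring
  linarith

theorem family_exists {N : ℕ} [NeZero N] {P C : Type} [Fintype P] [Fintype C]
    (hP : Fintype.card P = N + 2) (hC : Fintype.card C = N + 2) (p0 p1 : P) (hp : p0 ≠ p1)
    (a b : C) (hab : a ≠ b) :
    ∃ φ : Fin N → P → C, (∀ r, Function.Bijective (φ r)) ∧ (∀ r, φ r p0 = a) ∧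
      (∀ r, φ r p1 = b) ∧ ∀ p h, p ≠ p0 → p ≠ p1 → h ≠ a → h ≠ b → ∃ r, φ r p = h := by
  have cnt : ∀ {Q : Type} [Fintype Q] (q0 q1 : Q), q0 ≠ q1 → Fintype.card Q = N + 2 →
      Fintype.card {q : Q // q ≠ q0 ∧ q ≠ q1} = Fintype.card (Fin N) := by
    intro Q _ q0 q1 hq hQ
    rw [Fintype.card_subtype]
    have : (univ.filter fun q : Q => q ≠ q0 ∧ q ≠ q1) = univ \ {q0, q1} := by
      ext q; simp
    rw [this, Finset.card_sdiff_of_subset (by simp), Finset.card_pair hq, Finset.card_univ, hQ]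
    simp
  have e1 := Fintype.equivOfCardEq (cnt p0 p1 hp hP)
  have e2 := Fintype.equivOfCardEq (cnt a b hab hC)
  refine ⟨fun r p => if h : p ≠ p0 ∧ p ≠ p1 then (e2.symm (e1 ⟨p, h⟩ + r)).1
    else if p = p0 then a else b, ?_, ?_, ?_, ?_⟩
  · intro r
    rw [Fintype.bijective_iff_injective_and_card]
    refine ⟨?_, by rw [hP, hC]⟩
    intro p q hpq
    simp only at hpq
    by_cases h : p ≠ p0 ∧ p ≠ p1 <;> by_cases h' : q ≠ p0 ∧ q ≠ p1
    · rw [dif_pos h, dif_pos h'] at hpq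
      have := e1.injective (add_right_cancel (e2.symm.injective (Subtype.ext hpq)))
      exact congrArg Subtype.val this
    · rw [dif_pos h, dif_neg h'] at hpq
      have := (e2.symm (e1 ⟨p, h⟩ + r)).2
      split_ifs at hpq <;> simp [hpq] at this
    · rw [dif_neg h, dif_pos h'] at hpq
      have := (e2.symm (e1 ⟨q, h'⟩ + r)).2
      split_ifs at hpq <;> simp [← hpq] at this
    · rw [dif_neg h, dif_neg h'] at hpq
      split_ifs at hpq <;> grind
  · intro r; simp
  · intro r; simp [hp.symm]
  · intro p h h0 h1 ha hb
    refine ⟨e2 ⟨h, ha, hb⟩ - e1 ⟨p, h0, h1⟩, ?_⟩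
    simp [h0, h1]

set_option maxHeartbeats 2000000 in
theorem core {m N mt j k : ℕ} [NeZero N] (hjk : j < k) (δ ε : ℝ) (hε : 0 < ε)
    {P C : Type} [Fintype P] [Fintype C] [DecidableEq P] [DecidableEq C]
    (hP : Fintype.card P = N + 2) (hC : Fintype.card C = N + 2) (p0 p1 : P) (hp : p0 ≠ p1)
    (a b : Fin m → C) (hab : ∀ i, a i ≠ b i)
    (ha : ∀ h, (univ.filter fun i => a i = h).card ≤ mt)
    (hb : ∀ h, (univ.filter fun i => b i = h).card ≤ mt)
    (hm0 : 0 < m) (hm : m = (N + 2) * mt)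
    (E : Finset (Finset (Fin m × P))) (hE : ∀ e ∈ E, e.card = k)
    (hdeg : ∀ S : Finset (Fin m × P), S.card = j →
      (δ + 3 * ε / 4) * (((N + 2) * m : ℕ) : ℝ) ^ (k - j) ≤ ((E.filter fun e => S ⊆ e).card : ℝ))
    (hnum1 : (4 * m + k * (N + 2) : ℝ) ≤ ε / 8 * ((N + 2) * m : ℕ))
    (hnum2 : ((N + 2 : ℕ) : ℝ) * (((N + 2) * m : ℕ) : ℝ) ^ j * Real.exp (- (ε ^ 2 * m / 128)) < 1) :
    ∃ φ : Fin m → P → C, (∀ i, Function.Bijective (φ i)) ∧ (∀ i, φ i p0 = a i) ∧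
      (∀ i, φ i p1 = b i) ∧
      ∀ h, ∀ S : Finset (Fin m × P), S.card = j → (∀ v ∈ S, φ v.1 v.2 = h) →
        (δ + ε / 2) * (m : ℝ) ^ (k - j) ≤
          ((E.filter fun e => S ⊆ e ∧ ∀ v ∈ e, φ v.1 v.2 = h).card : ℝ) := by
  choose φ hbij hφ0 hφ1 hφr using fun i => family_exists (N := N) hP hC p0 p1 hp (a i) (b i) (hab i)
  obtain ⟨d, rfl⟩ : ∃ d, k = j + (d + 1) := ⟨k - j - 1, by omega⟩
  simp only [Nat.add_sub_cancel_left] at *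
  set V := (Finset.univ : Finset (Fin m × P)) with hV
  have hVc : V.card = (N + 2) * m := by simp [hV, hP, mul_comm]
  -- good edges
  let bad : C → Finset (Fin m × P) := fun h =>
    (univ : Finset (Fin m)) ×ˢ {p0, p1} ∪ (univ.filter fun i => a i = h) ×ˢ univ
      ∪ (univ.filter fun i => b i = h) ×ˢ univ
  have hbad : ∀ h, (bad h).card ≤ 4 * m := by
    intro h
    have h1 := ha h
    have h2 := hb h
    calc _ ≤ m * 2 + mt * (N + 2) + mt * (N + 2) := by
          refine (Finset.card_union_le _ _).trans (add_le_add ((Finset.card_union_le _ _).trans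
            (add_le_add ?_ ?_)) ?_)
          · rw [Finset.card_product, Finset.card_pair hp]; simp
          · rw [Finset.card_product, Finset.card_univ, hP]; gcongr
          · rw [Finset.card_product, Finset.card_univ, hP]; gcongr
      _ = 4 * m := by
          have : mt * (N + 2) = m := by rw [hm, mul_comm]
          rw [this]; ring
  let good : C → Finset (Fin m × P) → Finset (Finset (Fin m × P)) := fun h S =>
    E.filter fun e => S ⊆ e ∧ (∀ v ∈ e \ S, v ∉ bad h) ∧
      ∀ u ∈ e \ S, ∀ v ∈ e \ S, u.1 = v.1 → u = v
  have hsz : ∀ S : Finset (Fin m × P), S.card = j → ∀ e ∈ E, S ⊆ e → (e \ S).card = d + 1 := by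
    intro S hS e he hSe
    rw [Finset.card_sdiff_of_subset hSe, hE e he, hS]; omega
  have hgood : ∀ h S, S.card = j → (δ + 5 * ε / 8) * (((N + 2) * m : ℕ) : ℝ) ^ (d + 1) ≤
      ((good h S).card : ℝ) := by
    intro h S hS
    let badE : Finset (Finset (Fin m × P)) := (V.powersetCard d).biUnion fun W =>
      (bad h ∪ W.biUnion fun u => {u.1} ×ˢ univ).image fun v => S ∪ insert v W
    have hcov : (E.filter fun e => S ⊆ e) ⊆ good h S ∪ badE := by
      intro e he
      rw [Finset.mem_union]
      by_cases hg : e ∈ good h S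
      · exact Or.inl hg
      right
      obtain ⟨heE, hSe⟩ := Finset.mem_filter.1 he
      have hwit : ∃ v ∈ e \ S, v ∈ bad h ∨ ∃ u ∈ (e \ S).erase v, u.1 = v.1 := by
        by_contra hc
        push Not at hc
        apply hg
        refine Finset.mem_filter.2 ⟨heE, hSe, fun v hv => (hc v hv).1, fun u hu v hv huv => ?_⟩
        by_contra hne
        exact (hc v hv).2 u (Finset.mem_erase.2 ⟨hne, hu⟩) huv
      obtain ⟨v, hv, hv2⟩ := hwit
      refine Finset.mem_biUnion.2 ⟨(e \ S).erase v, ?_, ?_⟩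
      · rw [Finset.mem_powersetCard, Finset.card_erase_of_mem hv, hsz S hS e heE hSe]
        exact ⟨Finset.subset_univ _, rfl⟩
      · refine Finset.mem_image.2 ⟨v, ?_, ?_⟩
        · rw [Finset.mem_union]
          refine hv2.imp id ?_
          rintro ⟨u, hu, huv⟩
          exact Finset.mem_biUnion.2 ⟨u, hu, by simp [huv]⟩
        · rw [Finset.insert_erase hv, Finset.union_sdiff_of_subset hSe]
    have hbc : badE.card ≤ ((N + 2) * m) ^ d * (4 * m + (j + (d + 1)) * (N + 2)) := by
      refine (Finset.card_biUnion_le_card_mul _ _ (4 * m + (j + (d + 1)) * (N + 2)) ?_).trans ?_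
      · intro W hW
        refine Finset.card_image_le.trans ((Finset.card_union_le _ _).trans
          (add_le_add (hbad h) ?_))
        refine (Finset.card_biUnion_le_card_mul _ _ (N + 2) ?_).trans ?_
        · intro u _
          rw [Finset.card_product, Finset.card_univ, hP]; simp
        · rw [(Finset.mem_powersetCard.1 hW).2]
          gcongr; omega
      · rw [Finset.card_powersetCard, hVc]
        gcongr
        exact Nat.choose_le_pow _ _
    have h1 := (Finset.card_le_card hcov).trans (Finset.card_union_le _ _)
    have h2 : (((E.filter fun e => S ⊆ e).card : ℕ) : ℝ) ≤ (good h S).card + badE.card := by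
      exact_mod_cast h1
    have h3 : (badE.card : ℝ) ≤ (((N + 2) * m : ℕ) : ℝ) ^ d *
        (4 * m + (j + (d + 1) : ℕ) * (N + 2)) := by exact_mod_cast hbc
    have h4 : (((N + 2) * m : ℕ) : ℝ) ^ d * (4 * m + (j + (d + 1) : ℕ) * (N + 2)) ≤
        (((N + 2) * m : ℕ) : ℝ) ^ d * (ε / 8 * ((N + 2) * m : ℕ)) := by gcongr
    have h5 := hdeg S hS
    have h6 : (δ + 5 * ε / 8) * (((N + 2) * m : ℕ) : ℝ) ^ (d + 1) =
      (δ + 3 * ε / 4) * (((N + 2) * m : ℕ) : ℝ) ^ (d + 1) -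
        (((N + 2) * m : ℕ) : ℝ) ^ d * (ε / 8 * ((N + 2) * m : ℕ)) := by ring
    linarith
  let f : C → Finset (Fin m × P) → (Fin m → Fin N) → ℕ := fun h S ω =>
    ((good h S).filter fun e => ∀ v ∈ e \ S, φ v.1 (ω v.1) v.2 = h).card
  have hmean : ∀ h S, S.card = j → (δ + 5 * ε / 8) * (m : ℝ) ^ (d + 1) ≤
      (∑ ω, (f h S ω : ℝ)) / (Fintype.card (Fin N) : ℝ) ^ m := by
    intro h S hS
    have hNpos : (0 : ℝ) < N := by exact_mod_cast Nat.pos_of_ne_zero (NeZero.ne N)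
    have hswap : ∑ ω, f h S ω = ∑ e ∈ good h S,
        (univ.filter fun ω : Fin m → Fin N => ∀ v ∈ e \ S, φ v.1 (ω v.1) v.2 = h).card := by
      simp only [f, Finset.card_filter]
      exact Finset.sum_comm
    have hper : ∀ e ∈ good h S, N ^ m ≤
        (univ.filter fun ω : Fin m → Fin N => ∀ v ∈ e \ S, φ v.1 (ω v.1) v.2 = h).card *
          N ^ (d + 1) := by
      intro e he
      obtain ⟨heE, hSe, hnb, htr⟩ := Finset.mem_filter.1 he
      have hpi : (univ.filter fun ω : Fin m → Fin N => ∀ v ∈ e \ S, φ v.1 (ω v.1) v.2 = h) =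
          Fintype.piFinset fun i => univ.filter fun r => ∀ p, (i, p) ∈ e \ S → φ i r p = h := by
        ext ω
        simp only [Finset.mem_filter, Fintype.mem_piFinset, Finset.mem_univ, true_and]
        exact ⟨fun H i p hip => H (i, p) hip, fun H v hv => H v.1 v.2 hv⟩
      have hcnt : d + 1 = ∑ i : Fin m, ((e \ S).filter fun v => v.1 = i).card := by
        rw [← hsz S hS e heE hSe]
        exact Finset.card_eq_sum_card_fiberwise (fun _ _ => Finset.mem_univ _)
      rw [hpi, Fintype.card_piFinset, hcnt, ← Finset.prod_pow_eq_pow_sum, ← Finset.prod_mul_distrib]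
      calc N ^ m = ∏ i : Fin m, N := by simp
        _ ≤ _ := Finset.prod_le_prod (fun _ _ => Nat.zero_le _) fun i _ => ?_
      by_cases hex : ∃ p, (i, p) ∈ e \ S
      · obtain ⟨p, hpm⟩ := hex
        have hb1 := hnb _ hpm
        simp only [bad, Finset.mem_union, Finset.mem_product, Finset.mem_filter, Finset.mem_univ,
          true_and, and_true, Finset.mem_insert, Finset.mem_singleton, not_or] at hb1
        obtain ⟨r, hr⟩ := hφr i p h hb1.1.1.1 hb1.1.1.2 (Ne.symm hb1.1.2) (Ne.symm hb1.2)
        have hc1 : 1 ≤ (univ.filter fun r => ∀ p, (i, p) ∈ e \ S → φ i r p = h).card := by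
          refine Finset.card_pos.2 ⟨r, Finset.mem_filter.2 ⟨Finset.mem_univ _, fun q hq => ?_⟩⟩
          have := htr _ hq _ hpm rfl
          simp only [Prod.mk.injEq, true_and] at this
          rw [this, hr]
        have hc2 : 1 ≤ ((e \ S).filter fun v => v.1 = i).card :=
          Finset.card_pos.2 ⟨(i, p), Finset.mem_filter.2 ⟨hpm, rfl⟩⟩
        calc N = 1 * N ^ 1 := by simp
          _ ≤ _ := by
            gcongr
            exact Nat.pos_of_ne_zero (NeZero.ne N)
      · push Not at hex
        have : (univ.filter fun r => ∀ p, (i, p) ∈ e \ S → φ i r p = h) = univ := by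
          ext r; simp only [Finset.mem_filter, Finset.mem_univ, true_and, iff_true]
          exact fun p hpm => absurd hpm (hex p)
        rw [this, Finset.card_univ, Fintype.card_fin]
        exact Nat.le_mul_of_pos_right _ (pow_pos (Nat.pos_of_ne_zero (NeZero.ne N)) _)
    have hsum : (good h S).card * N ^ m ≤ (∑ ω, f h S ω) * N ^ (d + 1) := by
      rw [hswap, Finset.sum_mul, ← smul_eq_mul, ← Finset.sum_const]
      exact Finset.sum_le_sum hper
    have hsum' : ((good h S).card : ℝ) * (N : ℝ) ^ m ≤
        (∑ ω, (f h S ω : ℝ)) * ((N + 2 : ℕ) : ℝ) ^ (d + 1) := by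
      calc ((good h S).card : ℝ) * (N : ℝ) ^ m ≤ (∑ ω, (f h S ω : ℝ)) * (N : ℝ) ^ (d + 1) := by
            exact_mod_cast hsum
        _ ≤ _ := by
            gcongr
            omega
    have hg := hgood h S hS
    rw [Fintype.card_fin, le_div_iff₀ (by positivity)]
    have hT : (0 : ℝ) < ((N + 2 : ℕ) : ℝ) ^ (d + 1) := by positivity
    refine le_of_mul_le_mul_right ?_ hT
    refine le_trans (le_trans (le_of_eq ?_) (mul_le_mul_of_nonneg_right hg
      (pow_nonneg hNpos.le m))) hsum'
    rw [Nat.cast_mul, mul_pow]; ring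
  have hlip : ∀ h S, S.card = j → ∀ i ω ω', (∀ l, l ≠ i → ω l = ω' l) →
      (f h S ω : ℝ) - f h S ω' ≤ (m : ℝ) ^ d := by
    intro h S hS i ω ω' hω
    obtain ⟨p, hp1⟩ := (hbij i (ω i)).2 h
    let X := univ.filter fun v : Fin m × P => φ v.1 (ω v.1) v.2 = h
    have hX : X.card ≤ m := by
      have : X.card ≤ (univ : Finset (Fin m)).card := by
        refine Finset.card_le_card_of_injOn Prod.fst (fun _ _ => Finset.mem_coe.2 (Finset.mem_univ _)) ?_
        rintro ⟨u1, u2⟩ hu ⟨v1, v2⟩ hv huv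
        simp only [X, Finset.coe_filter, Finset.mem_univ, true_and, Set.mem_ofPred_eq] at hu hv huv
        subst huv
        rw [(hbij u1 (ω u1)).1 (hu.trans hv.symm)]
      simpa using this
    let D := (good h S).filter fun e => (∀ v ∈ e \ S, φ v.1 (ω v.1) v.2 = h) ∧ (i, p) ∈ e \ S
    have hD : D.card ≤ m ^ d := by
      calc D.card ≤ (X.powersetCard d).card := by
            refine Finset.card_le_card_of_injOn (fun e => (e \ S).erase (i, p)) ?_ ?_
            · intro e he
              obtain ⟨hg, hv, hip⟩ := Finset.mem_filter.1 (Finset.mem_coe.1 he)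
              obtain ⟨heE, hSe, -⟩ := Finset.mem_filter.1 hg
              rw [Finset.mem_coe, Finset.mem_powersetCard, Finset.card_erase_of_mem hip,
                hsz S hS e heE hSe]
              refine ⟨fun v hv' => ?_, rfl⟩
              exact Finset.mem_filter.2 ⟨Finset.mem_univ _, hv v (Finset.mem_of_mem_erase hv')⟩
            · intro e he e' he' hee
              obtain ⟨hg, hv, hip⟩ := Finset.mem_filter.1 (Finset.mem_coe.1 he)
              obtain ⟨heE, hSe, -⟩ := Finset.mem_filter.1 hg
              obtain ⟨hg', hv', hip'⟩ := Finset.mem_filter.1 (Finset.mem_coe.1 he')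
              obtain ⟨heE', hSe', -⟩ := Finset.mem_filter.1 hg'
              simp only at hee
              rw [← Finset.union_sdiff_of_subset hSe, ← Finset.union_sdiff_of_subset hSe',
                ← Finset.insert_erase hip, ← Finset.insert_erase hip', hee]
        _ = X.card.choose d := Finset.card_powersetCard _ _
        _ ≤ X.card ^ d := Nat.choose_le_pow _ _
        _ ≤ _ := by gcongr
    have hle : f h S ω ≤ f h S ω' + D.card := by
      refine le_trans (Finset.card_le_card ?_) (Finset.card_union_le _ _)
      intro e he
      obtain ⟨hg, hv⟩ := Finset.mem_filter.1 he
      rw [Finset.mem_union]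
      by_cases hip : (i, p) ∈ e \ S
      · exact Or.inr (Finset.mem_filter.2 ⟨hg, hv, hip⟩)
      · refine Or.inl (Finset.mem_filter.2 ⟨hg, fun v hvm => ?_⟩)
        have hvi : v.1 ≠ i := by
          rintro rfl
          apply hip
          rwa [(hbij v.1 (ω v.1)).1 (hp1.trans (hv v hvm).symm)]
        rw [← hω v.1 hvi]; exact hv v hvm
    have : (f h S ω : ℝ) ≤ f h S ω' + (m : ℝ) ^ d := by exact_mod_cast hle.trans (by gcongr)
    linarith
  have hm0' : (0 : ℝ) < m := by exact_mod_cast hm0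
  have htail : ∀ h S, S.card = j →
      ((univ.filter fun ω => (f h S ω : ℝ) < (δ + ε / 2) * (m : ℝ) ^ (d + 1)).card : ℝ) ≤
      (N : ℝ) ^ m * Real.exp (- (ε ^ 2 * m / 128)) := by
    intro h S hS
    have := mcd_tail ((m : ℝ) ^ d) (by positivity) m hm0 (fun ω => (f h S ω : ℝ)) (hlip h S hS)
      (ε / 8 * (m : ℝ) ^ (d + 1)) ((δ + ε / 2) * (m : ℝ) ^ (d + 1)) (by positivity) (by
        refine le_trans (le_of_eq ?_) (hmean h S hS)
        ring)
    simp only [Fintype.card_fin] at this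
    convert this using 4
    field_simp
    ring
  -- union bound
  obtain ⟨ω, hω⟩ : ∃ ω : Fin m → Fin N, ∀ h, ∀ S ∈ V.powersetCard j,
      (δ + ε / 2) * (m : ℝ) ^ (d + 1) ≤ f h S ω := by
    by_contra hcon
    push Not at hcon
    have hcov : (univ : Finset (Fin m → Fin N)) ⊆
        ((univ : Finset C) ×ˢ V.powersetCard j).biUnion fun q =>
          univ.filter fun ω => (f q.1 q.2 ω : ℝ) < (δ + ε / 2) * (m : ℝ) ^ (d + 1) := by
      intro ω _
      obtain ⟨h, S, hS, hlt⟩ := hcon ω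
      simp only [Finset.mem_biUnion, Finset.mem_product, Finset.mem_filter]
      exact ⟨(h, S), ⟨Finset.mem_univ _, hS⟩, Finset.mem_univ _, hlt⟩
    have h1 := (Finset.card_le_card hcov).trans Finset.card_biUnion_le
    have h2 : ((N : ℝ)) ^ m ≤ ∑ q ∈ (univ : Finset C) ×ˢ V.powersetCard j,
        (N : ℝ) ^ m * Real.exp (- (ε ^ 2 * m / 128)) := by
      calc ((N : ℝ)) ^ m = ((univ : Finset (Fin m → Fin N)).card : ℝ) := by simp
        _ ≤ _ := Nat.cast_le.2 h1
        _ ≤ _ := by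
          rw [Nat.cast_sum]
          refine Finset.sum_le_sum fun q hq => ?_
          exact htail q.1 q.2 (Finset.mem_powersetCard.1 (Finset.mem_product.1 hq).2).2
    rw [Finset.sum_const, Finset.card_product, Finset.card_univ, hC, Finset.card_powersetCard,
      hVc, nsmul_eq_mul] at h2
    have hNpos : (0 : ℝ) < (N : ℝ) ^ m := by
      have := Nat.pos_of_ne_zero (NeZero.ne N); positivity
    have h3 : (((N + 2) * m).choose j : ℝ) ≤ (((N + 2) * m : ℕ) : ℝ) ^ j := by
      exact_mod_cast Nat.choose_le_pow _ _
    have h4 : ((((N + 2) * ((N + 2) * m).choose j : ℕ)) : ℝ) ≤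
        ((N + 2 : ℕ) : ℝ) * (((N + 2) * m : ℕ) : ℝ) ^ j := by
      rw [Nat.cast_mul]; gcongr
    have h5 : (N : ℝ) ^ m ≤ (N : ℝ) ^ m * (((N + 2 : ℕ) : ℝ) * (((N + 2) * m : ℕ) : ℝ) ^ j *
        Real.exp (- (ε ^ 2 * m / 128))) := by
      refine h2.trans ?_
      calc _ ≤ ((N + 2 : ℕ) : ℝ) * (((N + 2) * m : ℕ) : ℝ) ^ j *
            ((N : ℝ) ^ m * Real.exp (- (ε ^ 2 * m / 128))) := by gcongr
        _ = _ := by ring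
    nlinarith
  refine ⟨fun i => φ i (ω i), fun i => hbij i _, fun i => hφ0 i _, fun i => hφ1 i _, ?_⟩
  intro h S hS hSh
  refine (hω h S (Finset.mem_powersetCard.2 ⟨Finset.subset_univ _, hS⟩)).trans ?_
  norm_cast
  apply Finset.card_le_card
  intro e he
  simp only [good, Finset.mem_filter] at he ⊢
  refine ⟨he.1.1, he.1.2.1, fun v hv => ?_⟩
  by_cases hvS : v ∈ S
  · exact hSh v hvS
  · exact he.2 v (Finset.mem_sdiff.2 ⟨hv, hvS⟩)

theorem nextIdx_orderEmb (I : Finset ℕ) {m : ℕ} [NeZero m] (hI : I.card = m) (i : Fin m) :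
    nextIdx I (I.orderEmbOfFin hI i) = I.orderEmbOfFin hI (i + 1) := by
  set idx := I.orderEmbOfFin hI with hidx
  have hmem : ∀ l, idx l ∈ I := fun l => Finset.orderEmbOfFin_mem I hI l
  have hsur : ∀ x ∈ I, ∃ l, idx l = x := by
    intro x hx
    have : x ∈ Set.range idx := by rw [hidx, Finset.range_orderEmbOfFin]; exact hx
    exact this
  have hmpos : 0 < m := Nat.pos_of_ne_zero (NeZero.ne m)
  by_cases hi : i.val + 1 < m
  · have hv : (i + 1 : Fin m).val = i.val + 1 := by
      rw [Fin.val_add, Fin.val_one', Nat.add_mod_mod, Nat.mod_eq_of_lt hi]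
    have hlt : i < i + 1 := by rw [Fin.lt_def, hv]; omega
    have hne : (I.filter fun i' => idx i < i').Nonempty :=
      ⟨idx (i + 1), Finset.mem_filter.2 ⟨hmem _, idx.lt_iff_lt.2 hlt⟩⟩
    rw [nextIdx, dif_pos hne]
    apply le_antisymm
    · exact Finset.min'_le _ _ (Finset.mem_filter.2 ⟨hmem _, idx.lt_iff_lt.2 hlt⟩)
    · refine Finset.le_min' _ _ _ fun y hy => ?_
      obtain ⟨hy1, hy2⟩ := Finset.mem_filter.1 hy
      obtain ⟨l, rfl⟩ := hsur y hy1
      have := idx.lt_iff_lt.1 hy2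
      rw [idx.le_iff_le, Fin.le_def, hv]
      rw [Fin.lt_def] at this; omega
  · have hv : (i + 1 : Fin m).val = 0 := by
      have : i.val + 1 = m := by have := i.2; omega
      rw [Fin.val_add, Fin.val_one', Nat.add_mod_mod, this, Nat.mod_self]
    have hne : ¬ (I.filter fun i' => idx i < i').Nonempty := by
      rintro ⟨y, hy⟩
      obtain ⟨hy1, hy2⟩ := Finset.mem_filter.1 hy
      obtain ⟨l, rfl⟩ := hsur y hy1
      have := idx.lt_iff_lt.1 hy2
      rw [Fin.lt_def] at this
      have := l.2
      omega
    have hne2 : I.Nonempty := ⟨_, hmem i⟩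
    rw [nextIdx, dif_neg hne, dif_pos hne2]
    apply le_antisymm
    · exact Finset.min'_le _ _ (hmem _)
    · refine Finset.le_min' _ _ _ fun y hy => ?_
      obtain ⟨l, rfl⟩ := hsur y hy
      rw [idx.le_iff_le, Fin.le_def, hv]; omega

theorem colour_exists (T mt m : ℕ) [NeZero m] (hT : 3 ≤ T) (hm : m = T * mt) :
    ∃ c : Fin m → Fin T, (∀ i, c (i + 1 + 1) ≠ c i) ∧
      ∀ h, (univ.filter fun i => c i = h).card = mt := by
  refine ⟨fun i => ⟨i.val % T, Nat.mod_lt _ (by omega)⟩, ?_, ?_⟩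
  · intro i h
    rw [Fin.mk.injEq] at h
    have hdvd : T ∣ m := ⟨mt, hm⟩
    have h1 : (i + 1 + 1 : Fin m).val ≡ i.val + 2 [MOD T] := by
      have : (i + 1 + 1 : Fin m).val ≡ i.val + 2 [MOD m] := by
        simp [Fin.val_add, Nat.ModEq, add_assoc]
      exact this.of_dvd hdvd
    have h2 : i.val + 2 ≡ i.val + 0 [MOD T] := h1.symm.trans h
    have h3 := (Nat.modEq_zero_iff_dvd.1 (Nat.ModEq.add_left_cancel' _ h2))
    have := Nat.le_of_dvd (by norm_num) h3
    omega
  · intro h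
    subst hm
    have e : (univ.filter fun i : Fin (T * mt) =>
        (⟨i.val % T, Nat.mod_lt _ (by omega)⟩ : Fin T) = h).card = (univ : Finset (Fin mt)).card := by
      refine (Finset.card_bij (fun (l : Fin mt) _ => (⟨h.val + T * l.val, ?_⟩ : Fin (T * mt)))
        ?_ ?_ ?_).symm
      · have h1 := h.2; have h2 := l.2
        calc h.val + T * l.val < T + T * l.val := by omega
          _ = T * (l.val + 1) := by ring
          _ ≤ T * mt := by gcongr; omega
      · intro l _
        simp [Fin.ext_iff, Nat.mod_eq_of_lt h.2]
      · intro l _ l' _ hl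
        simp only [Fin.mk.injEq] at hl
        have : T * l.val = T * l'.val := by omega
        exact Fin.ext (Nat.eq_of_mul_eq_mul_left (by omega) this)
      · intro i hi
        have hi' : i.val % T = h.val := by
          have := (Finset.mem_filter.1 hi).2
          exact congrArg Fin.val this
        refine ⟨⟨i.val / T, ?_⟩, Finset.mem_univ _, ?_⟩
        · exact Nat.div_lt_of_lt_mul i.2
        · apply Fin.ext
          simp only
          rw [← hi']; exact Nat.mod_add_div _ _
    rw [e]; simp

theorem numeric (ε : ℝ) (hε : 0 < ε) (j k : ℕ) (hj : 1 ≤ j) (hjk : j < k) :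
    ∃ t : ℕ, 2 ≤ t ∧ (4 * (mOf k t : ℝ) + k * (TOf k t)) ≤ ε / 8 * ((TOf k t * mOf k t : ℕ) : ℝ) ∧
      (TOf k t : ℝ) * ((TOf k t * mOf k t : ℕ) : ℝ) ^ j *
        Real.exp (- (ε ^ 2 * mOf k t / 128)) < 1 := by
  have hlim := Real.tendsto_pow_mul_exp_neg_atTop_nhds_zero (2 * j + 1)
  set c : ℝ := ε ^ 2 / 128 with hc
  have hc0 : 0 < c := by positivity
  have hev := (hlim.comp (Filter.tendsto_id.const_mul_atTop hc0)).eventually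
    (gt_mem_nhds (show (0 : ℝ) < c ^ (2 * j + 1) by positivity))
  obtain ⟨x0, hx0⟩ := Filter.eventually_atTop.1 hev
  obtain ⟨t0, ht0⟩ := exists_nat_ge (max x0 ((4 + k) * 8 / ε))
  refine ⟨max 2 t0, le_max_left _ _, ?_⟩
  set t := max 2 t0
  have ht2 : 2 ≤ t := le_max_left _ _
  have htt : (t0 : ℝ) ≤ t := by exact_mod_cast le_max_right _ _
  have hx : x0 ≤ t := (le_max_left _ _).trans (ht0.trans htt)
  have hy : (4 + k) * 8 / ε ≤ t := (le_max_right _ _).trans (ht0.trans htt)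
  have hTt : t ≤ TOf k t := by
    have : 1 ≤ k - 1 := by omega
    unfold TOf; nlinarith
  have hmt1 : 1 ≤ mtOf k t := Nat.one_le_pow _ _ (by omega)
  have hTm : TOf k t ≤ mOf k t := by unfold mOf; nlinarith
  generalize TOf k t = T at *
  generalize mOf k t = m at *
  have hT' : (t : ℝ) ≤ T := by exact_mod_cast hTt
  have hm' : (T : ℝ) ≤ m := by exact_mod_cast hTm
  have ht0' : (0 : ℝ) < t := by exact_mod_cast (by omega : 0 < t)
  have hmp : (0 : ℝ) < m := by linarith
  constructor
  · rw [div_le_iff₀ hε] at hy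
    have hyT : (4 + k) * 8 ≤ T * ε := hy.trans (by gcongr)
    push_cast
    calc 4 * (m : ℝ) + k * T ≤ 4 * m + k * m := by gcongr
      _ = ((4 + k) * 8) * m / 8 := by ring
      _ ≤ (T * ε) * m / 8 := by gcongr
      _ = _ := by ring
  · have h1 := hx0 m (by linarith)
    simp only [Function.comp, id] at h1
    rw [mul_pow, mul_assoc] at h1
    have h2 : (m : ℝ) ^ (2 * j + 1) * Real.exp (-(c * m)) < 1 := by
      have : (0 : ℝ) < c ^ (2 * j + 1) := by positivity
      exact lt_of_mul_lt_mul_left (by linarith) this.le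
    refine lt_of_le_of_lt ?_ h2
    have e : ε ^ 2 * (m : ℝ) / 128 = c * m := by rw [hc]; ring
    rw [e]
    gcongr
    push_cast
    calc (T : ℝ) * (T * m) ^ j ≤ m * (m * m) ^ j := by gcongr
      _ = _ := by rw [pow_succ, pow_mul]; ring

/-- Lemma: a suitable splitting with large minimum relative degree
admits a viable partition. -/
theorem suitable_splitting_admits_viable_partition (j k : ℕ) (hj : 1 ≤ j) (hjk : j < k)
    (ε : ℝ) (hε : 0 < ε) :
    ∃ (t : ℕ) (γ μ : ℝ) (n₀ : ℕ), 0 < t ∧ 0 < γ ∧ 0 < μ ∧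
      ∀ n : ℕ, n₀ ≤ n → (k - 1) ∣ n →
        ∀ G : HGraph k, G.verts.card = n →
          G.MinDegGe j ((looseHamThreshold j k + ε) * (n : ℝ) ^ (k - j)) →
          ∀ χ : Finset ℕ → ℕ, GloballyBounded G χ (μ * (n : ℝ) ^ (k - 1)) →
            ∀ H : LooseHamCycle k G, ∀ i₀ < numE G, ∀ I : Finset ℕ,
              IsSplitting H t I → I.card = mOf k t → i₀ ∈ I →
              Suitable χ ε (mOf k t) H t I i₀ →
              G.MinDegOnGe j (splitVerts H t I)
                ((looseHamThreshold j k + 3 * ε / 4) * (MOf k t : ℝ) ^ (k - j)) →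
              ∃ X : ℕ → Finset ℕ, IsViablePartition j ε t H I X := by
  obtain ⟨t, ht2, hnum1, hnum2⟩ := numeric ε hε j k hj hjk
  refine ⟨t, 1, 1, TOf k t, by omega, one_pos, one_pos, ?_⟩
  intro n hn hdvd G hGn _ χ _ H i₀ _ I hspl hIc _ _ hdeg
  have hk2 : 1 ≤ k - 1 := by omega
  have hT3 : 3 ≤ TOf k t := by unfold TOf; nlinarith
  have hmt1 : 1 ≤ mtOf k t := Nat.one_le_pow _ _ (by omega)
  have hm0 : 0 < mOf k t := Nat.mul_pos (by omega) hmt1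
  obtain ⟨m, hm⟩ : ∃ m, m = mOf k t := ⟨_, rfl⟩
  obtain ⟨N, hN⟩ : ∃ N, TOf k t = N + 2 := ⟨TOf k t - 2, by omega⟩
  have hN0 : NeZero N := ⟨by omega⟩
  have hmT : m = (N + 2) * mtOf k t := by rw [hm, ← hN]; rfl
  have hTt : N + 2 = t * (k - 1) + 1 := hN.symm
  unfold MOf at hdeg
  unfold IsViablePartition
  rw [← hm] at hIc hm0 hnum1 hnum2 hdeg ⊢
  rw [hN] at hnum1 hnum2 hdeg hn hT3 ⊢
  have hm0' : NeZero m := ⟨by omega⟩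
  set idx := I.orderEmbOfFin hIc with hidx
  have hmem : ∀ l, idx l ∈ I := fun l => Finset.orderEmbOfFin_mem I hIc l
  have hsur : ∀ x ∈ I, ∃ l, idx l = x := by
    intro x hx
    have : x ∈ Set.range idx := by rw [hidx, Finset.range_orderEmbOfFin]; exact hx
    exact this
  let vtx : Fin m × Fin (N + 2) → ℕ := fun v => H.σ ((idx v.1 * (k - 1) + v.2.val) % G.verts.card)
  have hpv : ∀ i, H.pVerts (idx i) t = univ.image fun p => vtx (i, p) := by
    intro i
    ext x
    simp only [LooseHamCycle.pVerts, Finset.mem_image, Finset.mem_range, Finset.mem_univ, true_and,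
      vtx, ← hTt]
    constructor
    · rintro ⟨r, hr, rfl⟩; exact ⟨⟨r, hr⟩, rfl⟩
    · rintro ⟨p, rfl⟩; exact ⟨p.1, p.2, rfl⟩
  have hvp : ∀ i p, vtx (i, p) ∈ H.pVerts (idx i) t := by
    intro i p; rw [hpv]; exact Finset.mem_image_of_mem _ (Finset.mem_univ p)
  have hinj : Function.Injective vtx := by
    rintro ⟨i, p⟩ ⟨i', p'⟩ h
    have hii : i = i' := by
      by_contra hne
      have := hspl.2 _ (hmem i) _ (hmem i') (fun h => hne (idx.injective h))
      exact Finset.disjoint_left.1 this (hvp i p) (h ▸ hvp i' p')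
    subst hii
    have hnpos : 0 < G.verts.card := by omega
    have h2 := H.injOn (Set.mem_Iio.2 (Nat.mod_lt _ hnpos)) (Set.mem_Iio.2 (Nat.mod_lt _ hnpos)) h
    have h3 : p.val ≡ p'.val [MOD G.verts.card] := Nat.ModEq.add_left_cancel' _ h2
    have hp := p.2; have hp' := p'.2
    have h4 := Nat.ModEq.eq_of_lt_of_lt h3 (by omega) (by omega)
    rw [Fin.ext h4]
  have hsv : splitVerts H t I = univ.image vtx := by
    ext x
    simp only [splitVerts, Finset.mem_biUnion, Finset.mem_image, Finset.mem_univ, true_and]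
    constructor
    · rintro ⟨i, hi, hx⟩
      obtain ⟨l, rfl⟩ := hsur i hi
      rw [hpv] at hx
      obtain ⟨p, -, rfl⟩ := Finset.mem_image.1 hx
      exact ⟨_, rfl⟩
    · rintro ⟨⟨i, p⟩, rfl⟩
      exact ⟨idx i, hmem i, hvp i p⟩
  let p0 : Fin (N + 2) := 0
  let p1 : Fin (N + 2) := Fin.last _
  have hp01 : p0 ≠ p1 := by simp [p0, p1, Fin.ext_iff]
  have hA : ∀ i, H.pEndA (idx i) = vtx (i, p0) := by intro i; simp [LooseHamCycle.pEndA, vtx, p0]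
  have hB : ∀ i, H.pEndB (idx i) t = vtx (i, p1) := by
    intro i
    have : t * (k - 1) = N + 1 := by omega
    simp [LooseHamCycle.pEndB, vtx, p1, this]
  have hse : ∀ x, x ∈ splitEnds H t I ↔ ∃ i, x = vtx (i, p0) ∨ x = vtx (i, p1) := by
    intro x
    simp only [splitEnds, Finset.mem_biUnion, LooseHamCycle.pEnds, Finset.mem_insert,
      Finset.mem_singleton]
    constructor
    · rintro ⟨i, hi, hx⟩
      obtain ⟨l, rfl⟩ := hsur i hi
      rw [hA, hB] at hx
      exact ⟨l, hx⟩
    · rintro ⟨i, hx⟩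
      exact ⟨idx i, hmem i, by rw [hA, hB]; exact hx⟩
  obtain ⟨c, hc2, hcc⟩ := colour_exists (N + 2) (mtOf k t) m hT3 hmT
  let E : Finset (Finset (Fin m × Fin (N + 2))) := univ.filter fun e => e.image vtx ∈ G.edges
  have himg : Function.Injective (fun e : Finset (Fin m × Fin (N + 2)) => e.image vtx) :=
    Finset.image_injective hinj
  have hpre : ∀ (U : Finset (Fin m × Fin (N + 2))) (S : Finset ℕ), S ⊆ U.image vtx →
      ∃ S', S' ⊆ U ∧ S'.image vtx = S ∧ S'.card = S.card := by
    intro U S hS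
    obtain ⟨S', hS', rfl⟩ := Finset.subset_image_iff.1 hS
    exact ⟨S', by exact_mod_cast hS', rfl, (Finset.card_image_of_injective _ hinj).symm⟩
  obtain ⟨φ, hbij, hφ0, hφ1, hφd⟩ := core (m := m) (N := N) (mt := mtOf k t) (j := j) (k := k) hjk
    (looseHamThreshold j k) ε hε (P := Fin (N + 2)) (C := Fin (N + 2)) (by simp) (by simp)
    p0 p1 hp01 (fun i => c (i - 1 - 1)) c
    (fun i => by
      have := hc2 (i - 1 - 1)
      rw [sub_add_cancel, sub_add_cancel] at this
      exact this.symm)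
    (fun h => by
      rw [← hcc h]
      refine Finset.card_le_card_of_injOn (fun i => i - 1 - 1) ?_ ?_
      · intro i hi
        simpa using hi
      · intro i _ i' _ hii
        simpa using hii)
    (fun h => (hcc h).le) hm0 hmT E
    (fun e he => by
      have := G.edge_card _ (Finset.mem_filter.1 he).2
      rwa [Finset.card_image_of_injective _ hinj] at this)
    (fun S hS => by
      have hd := hdeg (S.image vtx) (by rw [hsv]; exact Finset.image_subset_image (Finset.subset_univ _))
        (by rw [Finset.card_image_of_injective _ hinj, hS])
      refine hd.trans ?_
      norm_cast
      refine le_trans ?_ (Finset.card_image_le (f := fun e => e.image vtx))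
      apply Finset.card_le_card
      intro e he
      obtain ⟨he1, he2⟩ := Finset.mem_filter.1 he
      obtain ⟨he3, he4⟩ := Finset.mem_filter.1 he1
      rw [hsv] at he4
      obtain ⟨e', -, rfl, -⟩ := hpre _ _ he4
      refine Finset.mem_image.2 ⟨e', Finset.mem_filter.2
        ⟨Finset.mem_filter.2 ⟨Finset.mem_univ _, he3⟩, ?_⟩, rfl⟩
      exact (Finset.image_subset_image_iff hinj).1 he2)
    (by simpa using hnum1) hnum2
  let X : ℕ → Finset ℕ := fun h =>
    (univ.filter fun v : Fin m × Fin (N + 2) => (φ v.1 v.2).val = h).image vtx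
  have hXm : ∀ h v, vtx v ∈ X h ↔ (φ v.1 v.2).val = h := by
    intro h v
    simp only [X, Finset.mem_image, Finset.mem_filter, Finset.mem_univ, true_and]
    constructor
    · rintro ⟨w, hw, hwv⟩; rwa [← hinj hwv]
    · intro hv; exact ⟨v, hv, rfl⟩
  have hXsub : ∀ h x, x ∈ X h → ∃ v, vtx v = x := by
    intro h x hx
    obtain ⟨v, -, hv⟩ := Finset.mem_image.1 hx
    exact ⟨v, hv⟩
  refine ⟨X, ?_, ?_, ?_, ?_, ?_⟩
  · rw [hsv]
    ext x
    simp only [Finset.mem_biUnion, Finset.mem_range]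
    constructor
    · rintro ⟨h, -, hx⟩
      obtain ⟨v, rfl⟩ := hXsub h x hx
      exact Finset.mem_image_of_mem _ (Finset.mem_univ _)
    · intro hx
      obtain ⟨v, -, rfl⟩ := Finset.mem_image.1 hx
      exact ⟨_, (φ v.1 v.2).2, (hXm _ _).2 rfl⟩
  · intro h _ h' _ hne
    rw [Finset.disjoint_left]
    intro x hx hx'
    obtain ⟨v, rfl⟩ := hXsub h x hx
    exact hne (((hXm _ _).1 hx).symm.trans ((hXm _ _).1 hx'))
  · intro h _ i hi
    obtain ⟨l, rfl⟩ := hsur i hi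
    rw [Finset.card_le_one]
    intro x hx y hy
    rw [Finset.mem_inter, hpv] at hx hy
    obtain ⟨p, -, rfl⟩ := Finset.mem_image.1 hx.2
    obtain ⟨q, -, rfl⟩ := Finset.mem_image.1 hy.2
    have e1 := (hXm _ _).1 hx.1
    have e2 := (hXm _ _).1 hy.1
    have e3 : p = q := (hbij l).1 (Fin.ext (e1.trans e2.symm))
    rw [e3]
  · let pr : Fin m → Finset ℕ := fun i => {vtx (i, p1), vtx (i + 1 + 1, p0)}
    have hprm : ∀ i x, x ∈ pr i ↔ x = vtx (i, p1) ∨ x = vtx (i + 1 + 1, p0) := by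
      intro i x; simp [pr]
    have hprd : ∀ i i' x, x ∈ pr i → x ∈ pr i' → i = i' := by
      intro i i' x hx hx'
      rw [hprm] at hx hx'
      rcases hx with rfl | rfl <;> rcases hx' with h | h <;> have h := hinj h <;>
        simp only [Prod.mk.injEq] at h
      · exact h.1
      · exact absurd h.2.symm hp01
      · exact absurd h.2 hp01
      · exact add_right_cancel (add_right_cancel h.1)
    have hpri : Function.Injective pr := by
      intro i i' h
      exact hprd i i' (vtx (i, p1)) ((hprm _ _).2 (Or.inl rfl)) (h ▸ (hprm _ _).2 (Or.inl rfl))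
    refine ⟨univ.image pr, ⟨?_, ?_, ?_, ?_⟩, ?_⟩
    · intro p hp
      obtain ⟨i, -, rfl⟩ := Finset.mem_image.1 hp
      refine ⟨Finset.card_pair fun h => ?_, fun x hx => ?_⟩
      · have := hinj h
        simp only [Prod.mk.injEq] at this
        exact hp01 this.2.symm
      · rw [hse]
        rcases (hprm _ _).1 hx with h | h
        · exact ⟨_, Or.inr h⟩
        · exact ⟨_, Or.inl h⟩
    · intro p hp q hq hne
      obtain ⟨i, -, rfl⟩ := Finset.mem_image.1 hp
      obtain ⟨i', -, rfl⟩ := Finset.mem_image.1 hq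
      rw [Finset.disjoint_left]
      intro x hx hx'
      exact hne (by rw [hprd i i' x hx hx'])
    · ext x
      rw [hse]
      simp only [Finset.mem_biUnion, Finset.mem_image, Finset.mem_univ, true_and, id]
      constructor
      · rintro ⟨p, ⟨i, rfl⟩, hx⟩
        rcases (hprm _ _).1 hx with h | h
        · exact ⟨_, Or.inr h⟩
        · exact ⟨_, Or.inl h⟩
      · rintro ⟨i, h | h⟩
        · refine ⟨_, ⟨i - 1 - 1, rfl⟩, (hprm _ _).2 (Or.inr ?_)⟩
          rw [sub_add_cancel, sub_add_cancel]; exact h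
        · exact ⟨_, ⟨i, rfl⟩, (hprm _ _).2 (Or.inl h)⟩
    · set R : ℕ → ℕ → Prop := fun a b => ({a, b} : Finset ℕ) ∈ univ.image pr ∨
        ∃ i ∈ I, ({a, b} : Finset ℕ) = {H.pEndB i t, H.pEndA (nextIdx I i)} with hR
      have hRs : ∀ a b, R a b → R b a := by
        intro a b h
        simp only [hR] at h ⊢
        rwa [Finset.pair_comm b a]
      have hsymm : ∀ a b, Relation.ReflTransGen R a b → Relation.ReflTransGen R b a := by
        intro a b h
        induction h with
        | refl => exact Relation.ReflTransGen.refl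
        | tail _ h2 ih => exact Relation.ReflTransGen.head (hRs _ _ h2) ih
      have harc : ∀ i, R (vtx (i, p1)) (vtx (i + 1, p0)) := by
        intro i
        right
        refine ⟨idx i, hmem i, ?_⟩
        rw [nextIdx_orderEmb I hIc i, ← hidx, hA, hB]
      have hpair : ∀ i, R (vtx (i, p1)) (vtx (i + 1 + 1, p0)) :=
        fun i => Or.inl (Finset.mem_image_of_mem _ (Finset.mem_univ i))
      have hstep : ∀ i, Relation.ReflTransGen R (vtx (i, p1)) (vtx (i + 1, p1)) := fun i =>
        (Relation.ReflTransGen.single (hpair i)).tail (hRs _ _ (harc (i + 1)))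
      have hn : ∀ l : ℕ, ∀ hl : l < m,
          Relation.ReflTransGen R (vtx (0, p1)) (vtx (⟨l, hl⟩, p1)) := by
        intro l
        induction l with
        | zero => intro hl; exact Relation.ReflTransGen.refl
        | succ l ih =>
          intro hl
          have h1 := (ih (by omega)).trans (hstep ⟨l, by omega⟩)
          have e : (⟨l, by omega⟩ + 1 : Fin m) = ⟨l + 1, hl⟩ := by
            apply Fin.ext
            rw [Fin.val_add, Fin.val_one', Nat.add_mod_mod, Nat.mod_eq_of_lt hl]
          rwa [e] at h1
      have hall : ∀ u ∈ splitEnds H t I, Relation.ReflTransGen R (vtx (0, p1)) u := by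
        intro u hu
        rw [hse] at hu
        obtain ⟨i, rfl | rfl⟩ := hu
        · have := (hn (i - 1).1 (i - 1).2).tail (harc (i - 1))
          rwa [sub_add_cancel] at this
        · exact hn i.1 i.2
      intro u hu v hv
      exact (hsymm _ _ (hall u hu)).trans (hall v hv)
    · intro h hh
      have hh' := Finset.mem_range.1 hh
      have : ((univ.image pr).filter fun p => p ⊆ X h) =
          (univ.filter fun i => c i = ⟨h, hh'⟩).image pr := by
        ext p
        simp only [Finset.mem_filter, Finset.mem_image, Finset.mem_univ, true_and]
        have key : ∀ i, pr i ⊆ X h ↔ c i = ⟨h, hh'⟩ := by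
          intro i
          constructor
          · intro hs
            have := hs ((hprm i _).2 (Or.inl rfl))
            rw [hXm] at this
            simp only [hφ1] at this
            exact Fin.ext this
          · intro hci x hx
            rcases (hprm _ _).1 hx with rfl | rfl
            · rw [hXm]; simp only [hφ1, hci]
            · rw [hXm]; simp only [hφ0, add_sub_cancel_right, hci]
        constructor
        · rintro ⟨⟨i, rfl⟩, hs⟩; exact ⟨i, (key i).1 hs, rfl⟩
        · rintro ⟨i, hi, rfl⟩; exact ⟨⟨i, rfl⟩, (key i).2 hi⟩
      rw [this, Finset.card_image_of_injective _ hpri, hcc]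
  · intro h hh S hS hSc
    have hh' := Finset.mem_range.1 hh
    obtain ⟨S', hS', rfl, hcard⟩ := hpre _ _ hS
    have hd := hφd ⟨h, hh'⟩ S' (hcard.trans hSc) (fun v hv => by
      exact Fin.ext (Finset.mem_filter.1 (hS' hv)).2)
    refine hd.trans ?_
    norm_cast
    rw [← Finset.card_image_of_injective _ himg]
    apply Finset.card_le_card
    intro e he
    obtain ⟨e', he', rfl⟩ := Finset.mem_image.1 he
    obtain ⟨h1, h2, h3⟩ := Finset.mem_filter.1 he'
    refine Finset.mem_filter.2 ⟨Finset.mem_filter.2 ⟨(Finset.mem_filter.1 h1).2, ?_⟩,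
      Finset.image_subset_image h2⟩
    refine Finset.image_subset_image fun v hv => Finset.mem_filter.2 ⟨Finset.mem_univ _, ?_⟩
    rw [h3 v hv]

end
end
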